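/- arXiv:1001.1782 — 9 statements merged into one kernel-verified Lean document; each statement's English description precedes it below -/
import Mathlib

section
/- Let A ⊆ ℝ be an interval, k ≥ 1 an integer, and f ∈ C^k(A). Then the number of zeros counted with multiplicities satisfies N(f^{(k)}, A) ≥ N(f, A) − k, where f^{(k)} denotes the k-th derivative of f. -/
open Set

/-- `x` is a zero of `f` on `A` of multiplicity (exactly) `n`, for `f ∈ C^k(A)`:
all derivatives of order `< n` vanish at `x`, and either `n = k + 1` or the `n`-th
derivative does not vanish. -/
def IsZeroOfMult (k : ℕ) (f : ℝ → ℝ) (A : Set ℝ) (x : ℝ) (n : ℕ) : Prop :=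
  (∀ j < n, iteratedDerivWithin j f A x = 0) ∧
    (n = k + 1 ∨ iteratedDerivWithin n f A x ≠ 0)

/-- Rolle's theorem for finitely many zeros: between `n` zeros of `g` in an interval there are
at least `n - 1` further points at which the derivative of `g` vanishes. -/
theorem exists_finset_derivWithin_eq_zero {A : Set ℝ} (hA : A.OrdConnected) {g : ℝ → ℝ}
    (hg : ContinuousOn g A) (T : Finset ℝ) (hTA : (T : Set ℝ) ⊆ A) (hT : ∀ y ∈ T, g y = 0) :
    ∃ R : Finset ℝ, (R : Set ℝ) ⊆ A ∧ Disjoint R T ∧ (∀ y ∈ R, derivWithin g A y = 0) ∧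
      (∀ r ∈ R, ∃ t ∈ T, r < t) ∧ T.card ≤ R.card + 1 := by
  induction T using Finset.induction_on_max with
  | empty => exact ⟨∅, by simp⟩
  | insert a T hlt ih =>
    obtain rfl | hne := T.eq_empty_or_nonempty
    · exact ⟨∅, by simp⟩
    obtain ⟨R, hRA, hRT, hR, hRlt, hcard⟩ :=
      ih (fun y hy => hTA (Finset.mem_insert_of_mem hy))
        (fun y hy => hT y (Finset.mem_insert_of_mem hy))
    have hbT := T.max'_mem hne
    set b := T.max' hne
    have hsub : Icc b a ⊆ A :=
      hA.out (hTA (Finset.mem_insert_of_mem hbT)) (hTA (Finset.mem_insert_self a T))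
    obtain ⟨c, hc, hc0⟩ := exists_deriv_eq_zero (hlt b hbT) (hg.mono hsub)
      ((hT b (Finset.mem_insert_of_mem hbT)).trans (hT a (Finset.mem_insert_self a T)).symm)
    have hTb : ∀ t ∈ T, t ≤ b := fun t ht => T.le_max' t ht
    have hRb : ∀ r ∈ R, r < b := fun r hr => by
      obtain ⟨t, ht, hrt⟩ := hRlt r hr
      exact hrt.trans_le (hTb t ht)
    have hcR : c ∉ R := fun h => (hRb c h).not_gt hc.1
    have hcT : c ∉ T := fun h => (hTb c h).not_gt hc.1
    have haR : a ∉ R := fun h => (hRb a h).not_gt (hlt b hbT)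
    have haT : a ∉ T := fun h => (hlt a h).false
    refine ⟨insert c R, ?_, ?_, ?_, ?_, ?_⟩
    · rw [Finset.coe_insert]
      exact insert_subset (hsub (Ioo_subset_Icc_self hc)) hRA
    · rw [Finset.disjoint_insert_left, Finset.disjoint_insert_right, Finset.mem_insert, not_or]
      exact ⟨⟨hc.2.ne, hcT⟩, haR, hRT⟩
    · intro y hy
      obtain rfl | hy := Finset.mem_insert.1 hy
      · rw [derivWithin_of_mem_nhds (Filter.mem_of_superset (Icc_mem_nhds hc.1 hc.2) hsub), hc0]
      · exact hR y hy
    · intro r hr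
      refine ⟨a, Finset.mem_insert_self a T, ?_⟩
      obtain rfl | hr := Finset.mem_insert.1 hr
      · exact hc.2
      · exact (hRb r hr).trans (hlt b hbT)
    · rw [Finset.card_insert_of_notMem hcR, Finset.card_insert_of_notMem haT]
      omega

/-- Iterated derivatives of a `C^k` function on an interval, which may be degenerate, are
continuous up to order `k`. -/
theorem ContDiffOn.continuousOn_iteratedDerivWithin_of_ordConnected {A : Set ℝ}
    (hA : A.OrdConnected) {f : ℝ → ℝ} {k : ℕ} (hf : ContDiffOn ℝ k f A) {j : ℕ} (hj : j ≤ k) :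
    ContinuousOn (iteratedDerivWithin j f A) A := by
  obtain hs | hs := A.subsingleton_or_nontrivial
  · exact hs.continuousOn _
  · obtain ⟨a, ha, b, hb, hab⟩ := hs.exists_lt
    have hint : (interior A).Nonempty := (nonempty_Ioo.2 hab).mono
      (interior_maximal (Ioo_subset_Icc_self.trans (hA.out ha hb)) isOpen_Ioo)
    exact hf.continuousOn_iteratedDerivWithin (by exact_mod_cast hj)
      (uniqueDiffOn_convex hA.convex hint)

/-- Counting step of the iterated Rolle argument: the `j`-th derivative has enough zeros in `A`,
among them all `x i` of multiplicity greater than `j`. -/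
theorem exists_finset_iteratedDerivWithin_eq_zero {A : Set ℝ} (hA : A.OrdConnected)
    {f : ℝ → ℝ} {k : ℕ} (hf : ContDiffOn ℝ k f A) {ι : Type*} [Fintype ι] {x : ι → ℝ}
    (hx : Function.Injective x) (hxA : ∀ i, x i ∈ A) {n : ι → ℕ} (hpos : ∀ i, 1 ≤ n i)
    (hzero : ∀ i, ∀ j < n i, iteratedDerivWithin j f A (x i) = 0) {j : ℕ} (hj : j ≤ k) :
    ∃ T : Finset ℝ, (T : Set ℝ) ⊆ A ∧ (∀ y ∈ T, iteratedDerivWithin j f A y = 0) ∧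
      (∀ i, j < n i → x i ∈ T) ∧ ∑ i, n i ≤ T.card + ∑ i, (n i - (j + 1)) + j := by
  induction j with
  | zero =>
    refine ⟨Finset.univ.map ⟨x, hx⟩, ?_, ?_, ?_, ?_⟩
    · rintro y hy
      obtain ⟨i, -, rfl⟩ := Finset.mem_map.1 hy
      exact hxA i
    · rintro y hy
      obtain ⟨i, -, rfl⟩ := Finset.mem_map.1 hy
      exact hzero i 0 (hpos i)
    · exact fun i _ => Finset.mem_map_of_mem ⟨x, hx⟩ (Finset.mem_univ i)
    · rw [Finset.card_map, Finset.card_eq_sum_ones, add_zero, ← Finset.sum_add_distrib]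
      exact Finset.sum_le_sum fun i _ => by omega
  | succ j ih =>
    obtain ⟨T, hTA, hT, hxT, hcard⟩ := ih (by omega)
    obtain ⟨R, hRA, hRT, hR, -, hRcard⟩ := exists_finset_derivWithin_eq_zero hA
      (hf.continuousOn_iteratedDerivWithin_of_ordConnected hA (by omega : j ≤ k)) T hTA hT
    set S : Finset ℝ := (Finset.univ.filter fun i => j + 1 < n i).map ⟨x, hx⟩ with hS
    have hmemS : ∀ y ∈ S, ∃ i, j + 1 < n i ∧ x i = y := fun y hy => by
      simpa [hS] using hy
    have hRS : Disjoint R S := hRT.mono_right fun y hy => by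
      obtain ⟨i, hi, rfl⟩ := hmemS y hy
      exact hxT i (by omega)
    refine ⟨R ∪ S, ?_, ?_, ?_, ?_⟩
    · intro y hy
      obtain hy | hy := Finset.mem_union.1 hy
      · exact hRA hy
      · obtain ⟨i, -, rfl⟩ := hmemS y hy
        exact hxA i
    · intro y hy
      obtain hy | hy := Finset.mem_union.1 hy
      · rw [iteratedDerivWithin_succ]
        exact hR y hy
      · obtain ⟨i, hi, rfl⟩ := hmemS y hy
        exact hzero i _ hi
    · intro i hi
      exact Finset.mem_union_right _ (Finset.mem_map_of_mem ⟨x, hx⟩ (by simpa using hi))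
    · have hsum : ∑ i, (n i - (j + 1)) = S.card + ∑ i, (n i - (j + 1 + 1)) := by
        rw [hS, Finset.card_map, Finset.card_filter, ← Finset.sum_add_distrib]
        refine Finset.sum_congr rfl fun i _ => ?_
        split_ifs <;> omega
      rw [Finset.card_union_of_disjoint hRS]
      omega

/-- If `A ⊆ ℝ` is an interval, `k ≥ 1`, and `f ∈ C^k(A)`, then
`N(f^{(k)}, A) ≥ N(f, A) - k` for zeros counted with multiplicities: for every finite
collection of zeros `x₁ < … < x_m` of `f` in `A` with multiplicities `n₁, …, n_m`
(each `nᵢ ≤ k + 1`), the `k`-th derivative `f^{(k)}` (which is only `C^0`, so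
multiplicities are capped at `1`) has at least `n₁ + ⋯ + n_m - k` zeros in `A`. -/
theorem iteratedDeriv_zeros_count (k : ℕ) (hk : 1 ≤ k) (A : Set ℝ) (hA : A.OrdConnected)
    (f : ℝ → ℝ) (hf : ContDiffOn ℝ k f A)
    (m : ℕ) (x : Fin m → ℝ) (hx : StrictMono x) (hxA : ∀ i, x i ∈ A)
    (nmul : Fin m → ℕ) (hpos : ∀ i, 1 ≤ nmul i) (hcap : ∀ i, nmul i ≤ k + 1)
    (hmul : ∀ i, IsZeroOfMult k f A (x i) (nmul i)) :
    ∃ T : Finset ℝ, (↑T : Set ℝ) ⊆ A ∧ (∀ y ∈ T, iteratedDerivWithin k f A y = 0) ∧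
      (∑ i, nmul i) - k ≤ T.card := by
  obtain ⟨T, hTA, hT, -, hcard⟩ := exists_finset_iteratedDerivWithin_eq_zero hA hf hx.injective
    hxA hpos (fun i => (hmul i).1) le_rfl
  have hsum : ∑ i, (nmul i - (k + 1)) = 0 :=
    Finset.sum_eq_zero fun i _ => Nat.sub_eq_zero_of_le (hcap i)
  exact ⟨T, hTA, hT, by omega⟩
end

section
/- The closed convex hull of the set {Γ(y) : y > 0} is an n-dimensional subset of ℝⁿ, i.e., it has nonempty interior. -/
open Set

/-- The curve `Γ : (0, ∞) → ℝⁿ`, `Γ(y)ᵢ = k (y - Xᵢ)₊^{k-1} / y^k`. -/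
noncomputable def Gamma (k n : ℕ) (X : Fin n → ℝ) (y : ℝ) : Fin n → ℝ :=
  fun i => (k : ℝ) * max (y - X i) 0 ^ (k - 1) / y ^ k

theorem Gamma_eq_zero_of_le {k n : ℕ} (hk : 2 ≤ k) {X : Fin n → ℝ} {y : ℝ} {i : Fin n}
    (h : y ≤ X i) : Gamma k n X y i = 0 := by
  have hk' : k - 1 ≠ 0 := by omega
  simp [Gamma, max_eq_right (sub_nonpos.2 h), hk']

theorem Gamma_pos_of_lt {k n : ℕ} (hk : k ≠ 0) {X : Fin n → ℝ} {y : ℝ} {i : Fin n}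
    (hy : 0 < y) (h : X i < y) : 0 < Gamma k n X y i := by
  have hyX : 0 < y - X i := sub_pos.2 h
  have hk' : (0 : ℝ) < k := by positivity
  simp only [Gamma, max_eq_left hyX.le]
  positivity

theorem StrictMono.exists_gt_forall_le {n : ℕ} {X : Fin n → ℝ} (hX : StrictMono X) (j : Fin n) :
    ∃ y, X j < y ∧ ∀ i, j < i → y ≤ X i := by
  have h : ∀ᶠ y in nhdsWithin (X j) (Ioi (X j)), ∀ i, j < i → y ≤ X i := by
    refine Filter.eventually_all.2 fun i => ?_
    by_cases hij : j < i
    · filter_upwards [Ioc_mem_nhdsGT (hX hij)] with y hy _ using hy.2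
    · exact Filter.Eventually.of_forall fun y h => absurd h hij
  obtain ⟨y, hy, hyX⟩ := ((eventually_mem_nhdsWithin (s := Ioi (X j))).and h).exists
  exact ⟨y, hy, hyX⟩

theorem span_Gamma_eq_top {k n : ℕ} (hk : 2 ≤ k) {X : Fin n → ℝ} (hX : StrictMono X)
    (hXpos : ∀ i, 0 < X i) : Submodule.span ℝ (Gamma k n X '' Ioi 0) = ⊤ := by
  choose y hy hyX using hX.exists_gt_forall_le
  let A : Matrix (Fin n) (Fin n) ℝ := Matrix.of fun j => Gamma k n X (y j)
  have hdet : A.det ≠ 0 := by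
    rw [Matrix.det_of_isLowerTriangular A fun j i hji => Gamma_eq_zero_of_le hk (hyX j i hji)]
    exact Finset.prod_ne_zero_iff.2 fun j _ =>
      (Gamma_pos_of_lt (by omega) ((hXpos j).trans (hy j)) (hy j)).ne'
  have hspan : Submodule.span ℝ (range A.row) = ⊤ :=
    (Matrix.linearIndependent_rows_of_det_ne_zero hdet).span_eq_top_of_card_eq_finrank' (by simp)
  refine top_unique (hspan.ge.trans (Submodule.span_mono ?_))
  rintro _ ⟨j, rfl⟩
  exact ⟨y j, (hXpos j).trans (hy j), rfl⟩

/-- The closed convex hull of `{Γ(y) : y > 0}` is an `n`-dimensional subset of `ℝⁿ`,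
i.e., it has nonempty interior. -/
theorem gamma_closedConvexHull_interior_nonempty (k n : ℕ) (hk : 2 ≤ k) (hn : 1 ≤ n)
    (X : Fin n → ℝ) (hX : StrictMono X) (hXpos : ∀ i, 0 < X i) :
    (interior (closure (convexHull ℝ (Gamma k n X '' Ioi 0)))).Nonempty := by
  have hzero : (0 : Fin n → ℝ) ∈ Gamma k n X '' Ioi 0 :=
    ⟨X ⟨0, hn⟩, hXpos _, funext fun i =>
      Gamma_eq_zero_of_le hk (hX.monotone (Fin.mk_le_of_le_val (Nat.zero_le _)))⟩
  refine Nonempty.mono (interior_mono subset_closure) ?_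
  rw [interior_convexHull_nonempty_iff_affineSpan_eq_top, ← insert_eq_of_mem hzero]
  apply SetLike.coe_injective
  rw [affineSpan_insert_zero, span_Gamma_eq_top hk hX hXpos]
  simp
end

section
/- Let K ⊆ [0, ∞)ⁿ be a compact convex set that contains at least one point with all coordinates strictly positive. Then the function z ↦ ∏_{i=1}^n z_i attains its maximum over K at a unique point b, and every coordinate of b is strictly positive. -/
open Set

/-- Two distinct positive vectors satisfy a strict product inequality at their midpoint. -/
theorem prod_mul_prod_lt_sq_prod_midpoint {ι : Type*} [Fintype ι] {x y : ι → ℝ}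
    (hx : ∀ i, 0 < x i) (hy : ∀ i, 0 < y i) (hxy : x ≠ y) :
    (∏ i, x i) * ∏ i, y i < (∏ i, midpoint ℝ x y i) ^ 2 := by
  have hmid (i : ι) : midpoint ℝ x y i = (x i + y i) / 2 := by
    rw [midpoint_eq_smul_add]
    simp [div_eq_inv_mul]
  obtain ⟨j, hj⟩ := Function.ne_iff.mp hxy
  rw [← Finset.prod_mul_distrib, ← Finset.prod_pow]
  refine Finset.prod_lt_prod (fun i _ => mul_pos (hx i) (hy i)) (fun i _ => ?_)
    ⟨j, Finset.mem_univ j, ?_⟩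
  · rw [hmid]
    nlinarith [sq_nonneg (x i - y i)]
  · rw [hmid]
    nlinarith [sq_pos_of_ne_zero (sub_ne_zero.mpr hj)]

/-- Let `K ⊆ [0, ∞)ⁿ` be a compact convex set containing at least one point with all
coordinates strictly positive.  Then `z ↦ ∏ᵢ zᵢ` attains its maximum over `K` at a
unique point `b`, and every coordinate of `b` is strictly positive. -/
theorem product_unique_maximizer (n : ℕ) (hn : 1 ≤ n) (K : Set (Fin n → ℝ))
    (hKcompact : IsCompact K) (hKconv : Convex ℝ K)
    (hKnonneg : K ⊆ {z | ∀ i, 0 ≤ z i}) (hKpos : ∃ z ∈ K, ∀ i, 0 < z i) :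
    ∃ b ∈ K, (∀ i, 0 < b i) ∧ (∀ z ∈ K, ∏ i, z i ≤ ∏ i, b i) ∧
      ∀ z ∈ K, (∀ w ∈ K, ∏ i, w i ≤ ∏ i, z i) → z = b := by
  obtain ⟨p, hpK, hp⟩ := hKpos
  have hcont : ContinuousOn (fun z : Fin n → ℝ => ∏ i, z i) K := by fun_prop
  obtain ⟨b, hbK, hb⟩ := hKcompact.exists_isMaxOn ⟨p, hpK⟩ hcont
  have hmax : ∀ z ∈ K, ∏ i, z i ≤ ∏ i, b i := fun z hz => hb hz
  have pos_of_max : ∀ z ∈ K, (∀ w ∈ K, ∏ i, w i ≤ ∏ i, z i) → ∀ i, 0 < z i := by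
    intro z hz hzmax i
    have hprod : 0 < ∏ i, z i := (Finset.prod_pos fun i _ => hp i).trans_le (hzmax p hpK)
    exact (hKnonneg hz i).lt_of_ne'
      (Finset.prod_ne_zero_iff.mp hprod.ne' i (Finset.mem_univ i))
  refine ⟨b, hbK, pos_of_max b hbK hmax, hmax, fun z hz hzmax => ?_⟩
  by_contra hne
  have hlt := prod_mul_prod_lt_sq_prod_midpoint (pos_of_max z hz hzmax)
    (pos_of_max b hbK hmax) hne
  have hmK : midpoint ℝ z b ∈ K := hKconv.midpoint_mem hz hbK
  rw [(hmax z hz).antisymm (hzmax b hbK), ← sq] at hlt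
  exact hlt.not_ge (pow_le_pow_left₀
    (Finset.prod_nonneg fun i _ => hKnonneg hmK i) (hmax _ hmK) 2)
end

section
/- Let b ∈ ℝⁿ be the unique maximizer of z ↦ ∏_{i=1}^n z_i over the closed convex hull of {Γ(y) : y > 0}, and set v_i = k/(n b_i) and p(y) = y^k − Σ_{i=1}^n v_i (y − X_i)₊^{k−1}. Then p(y) ≥ 0 for all y ≥ 0, and for y > 0 one has p(y) = 0 if and only if Σ_{i=1}^n Γ(y)_i / b_i = n. -/
open Set

/-- First-order condition: if `b` has positive coordinates and maximizes the product of
coordinates over a convex set `C`, then `C` lies in the half-space `∑ i, z i / b i ≤ n`. -/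
theorem sum_div_le_card_of_prod_le {ι : Type*} [Fintype ι] {C : Set (ι → ℝ)}
    (hC : Convex ℝ C) {b : ι → ℝ} (hb : b ∈ C) (hpos : ∀ i, 0 < b i)
    (hmax : ∀ z ∈ C, ∏ i, z i ≤ ∏ i, b i) {z : ι → ℝ} (hz : z ∈ C) :
    ∑ i, z i / b i ≤ Fintype.card ι := by
  classical
  have hderiv : HasDerivAt (fun t : ℝ => ∏ i, (1 + t * (z i / b i - 1)))
      (∑ i, (z i / b i - 1)) 0 := by
    have h := HasDerivAt.fun_finsetProd (u := Finset.univ) (x := (0 : ℝ))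
      (f := fun i t => 1 + t * (z i / b i - 1)) (f' := fun i => z i / b i - 1)
      (fun i _ => by
        simpa using ((hasDerivAt_id (0 : ℝ)).mul_const (z i / b i - 1)).const_add 1)
    simpa using h
  have hle : ∀ t ∈ Ioo (0 : ℝ) 1, ∏ i, (1 + t * (z i / b i - 1)) ≤ 1 := by
    intro t ht
    have h := hmax _ (hC hb hz (sub_nonneg.2 ht.2.le) ht.1.le (by ring))
    have heq : ∏ i, ((1 - t) • b + t • z) i
        = (∏ i, b i) * ∏ i, (1 + t * (z i / b i - 1)) := by
      rw [← Finset.prod_mul_distrib]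
      refine Finset.prod_congr rfl fun i _ => ?_
      have := (hpos i).ne'
      simp only [Pi.add_apply, Pi.smul_apply, smul_eq_mul]
      field_simp
      ring
    rw [heq] at h
    exact (mul_le_iff_le_one_right (Finset.prod_pos fun i _ => hpos i)).1 h
  have hnonpos : ∑ i, (z i / b i - 1) ≤ 0 := by
    refine le_of_tendsto hderiv.tendsto_slope_zero_right ?_
    filter_upwards [Ioo_mem_nhdsGT (zero_lt_one' ℝ)] with t ht
    have h := hle t ht
    simpa using mul_nonpos_of_nonneg_of_nonpos (inv_nonneg.2 ht.1.le) (sub_nonpos.2 h)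
  simpa [Finset.sum_sub_distrib] using hnonpos

theorem Gamma_nonneg (k n : ℕ) (X : Fin n → ℝ) {y : ℝ} (hy : 0 < y) : 0 ≤ Gamma k n X y :=
  fun i => by
    simp only [Gamma, Pi.zero_apply]
    positivity

theorem nonneg_of_mem_closure_convexHull_Gamma {k n : ℕ} {X z : Fin n → ℝ}
    (hz : z ∈ closure (convexHull ℝ (Gamma k n X '' Ioi 0))) : 0 ≤ z := by
  refine closure_minimal (convexHull_min ?_ (convex_Ici 0)) isClosed_Ici hz
  rintro _ ⟨y, hy, rfl⟩
  exact Gamma_nonneg k n X hy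

theorem exists_Gamma_pos {k : ℕ} (hk : k ≠ 0) (n : ℕ) (X : Fin n → ℝ) :
    ∃ y > 0, ∀ i, 0 < Gamma k n X y i := by
  obtain ⟨M, hM⟩ := (finite_range X).bddAbove
  refine ⟨max M 0 + 1, by positivity, fun i => ?_⟩
  have hi : 0 < max M 0 + 1 - X i := by
    linarith [hM (mem_range_self i), le_max_left M 0]
  have hk' : 0 < k := hk.bot_lt
  simp only [Gamma]
  rw [max_eq_left hi.le]
  positivity

/-- Let `b` be the unique maximizer of `z ↦ ∏ᵢ zᵢ` over the closed convex hull of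
`{Γ(y) : y > 0}`, and set `vᵢ = k / (n bᵢ)` and
`p(y) = y^k - ∑ᵢ vᵢ (y - Xᵢ)₊^{k-1}`.  Then `p(y) ≥ 0` for all `y ≥ 0`, and for `y > 0`
one has `p(y) = 0` if and only if `∑ᵢ Γ(y)ᵢ / bᵢ = n`. -/
theorem support_polynomial_nonneg (k n : ℕ) (hk : 2 ≤ k) (hn : 1 ≤ n)
    (X : Fin n → ℝ) (hX : StrictMono X) (hXpos : ∀ i, 0 < X i)
    (b : Fin n → ℝ) (hb : b ∈ closure (convexHull ℝ (Gamma k n X '' Ioi 0)))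
    (hbmax : ∀ z ∈ closure (convexHull ℝ (Gamma k n X '' Ioi 0)),
      ∏ i, z i ≤ ∏ i, b i)
    (hbuniq : ∀ z ∈ closure (convexHull ℝ (Gamma k n X '' Ioi 0)),
      (∀ w ∈ closure (convexHull ℝ (Gamma k n X '' Ioi 0)), ∏ i, w i ≤ ∏ i, z i) → z = b)
    (v : Fin n → ℝ) (hv : ∀ i, v i = k / (n * b i))
    (p : ℝ → ℝ) (hp : ∀ y, p y = y ^ k - ∑ i, v i * max (y - X i) 0 ^ (k - 1)) :
    (∀ y ≥ 0, 0 ≤ p y) ∧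
    ∀ y > 0, (p y = 0 ↔ ∑ i, Gamma k n X y i / b i = n) := by
  set C := closure (convexHull ℝ (Gamma k n X '' Ioi 0))
  have hmem : ∀ y > 0, Gamma k n X y ∈ C := fun y hy =>
    subset_closure (subset_convexHull ℝ _ (mem_image_of_mem _ hy))
  have hbpos : ∀ i, 0 < b i := by
    obtain ⟨y, hy, hpos⟩ := exists_Gamma_pos (by omega : k ≠ 0) n X
    have hprod : 0 < ∏ i, b i :=
      (Finset.prod_pos fun i _ => hpos i).trans_le (hbmax _ (hmem y hy))
    exact fun i => (nonneg_of_mem_closure_convexHull_Gamma hb i).lt_of_ne'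
      (Finset.prod_ne_zero_iff.1 hprod.ne' i (Finset.mem_univ i))
  have hn0 : (0 : ℝ) < n := by exact_mod_cast hn
  have hsum : ∀ y > 0, ∑ i, Gamma k n X y i / b i ≤ n := fun y hy => by
    simpa using sum_div_le_card_of_prod_le (convex_convexHull ℝ _).closure hb hbpos hbmax
      (hmem y hy)
  have hpy : ∀ y > 0, p y = y ^ k / n * (n - ∑ i, Gamma k n X y i / b i) := by
    intro y hy
    rw [hp, mul_sub, div_mul_cancel₀ _ hn0.ne', Finset.mul_sum]
    congr 1
    refine Finset.sum_congr rfl fun i _ => ?_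
    have := (hbpos i).ne'
    rw [hv, Gamma]
    field_simp
  refine ⟨fun y hy => ?_, fun y hy => ?_⟩
  · rcases hy.eq_or_lt' with rfl | hy
    · have hk0 : k ≠ 0 := by omega
      have hk1 : k - 1 ≠ 0 := by omega
      simp [hp, hk0, hk1, (hXpos _).le]
    · rw [hpy y hy]
      exact mul_nonneg (by positivity) (sub_nonneg.2 (hsum y hy))
  · have hne : y ^ k / n ≠ 0 := by positivity
    rw [hpy y hy, mul_eq_zero, or_iff_right hne, sub_eq_zero, eq_comm]
end

section
/- Let k ≥ 2 be an integer, 0 < X₁ < X₂ < … < X_n, and v₁, …, v_n > 0. Suppose p(y) = y^k − Σ_{i=1}^n v_i (y − X_i)₊^{k−1} satisfies p(y) ≥ 0 for all y ≥ 0, and let Y = {y > 0 : p(y) = 0}. Then for every j with 1 ≤ j ≤ n, the set Y contains at most j − 1 points in the interval (0, X_j]. In particular, Y is finite with at most n elements, and if Y = {Y₁ < Y₂ < … < Y_m} then Y_j > X_j for all j ≤ m. -/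
open Set

/-- If every finite subset of `s` has at most `N` elements then `s` is finite with at most `N`
elements. -/
theorem Set.finite_and_ncard_le_of_forall_finset {α : Type*} {s : Set α} {N : ℕ}
    (h : ∀ S : Finset α, (∀ y ∈ S, y ∈ s) → S.card ≤ N) : s.Finite ∧ s.ncard ≤ N := by
  have hs : s.Finite := by
    by_contra hinf
    obtain ⟨t, hts, htc⟩ := Set.Infinite.exists_subset_card_eq hinf (N + 1)
    have := h t fun y hy => hts hy
    omega
  refine ⟨hs, ?_⟩
  rw [Set.ncard_eq_toFinset_card s hs]
  exact h _ fun y hy => hs.mem_toFinset.1 hy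

/-- The function `a y ^ (d + 1) - ∑ cᵢ (y - Xᵢ)₊ ^ d`. -/
noncomputable def truncatedPowerSum {ι : Type*} (I : Finset ι) (X c : ι → ℝ) (a : ℝ) (d : ℕ)
    (y : ℝ) : ℝ :=
  a * y ^ (d + 1) - ∑ i ∈ I, c i * max (y - X i) 0 ^ d

theorem continuous_truncatedPowerSum {ι : Type*} (I : Finset ι) (X c : ι → ℝ) (a : ℝ) (d : ℕ) :
    Continuous (truncatedPowerSum I X c a d) := by
  unfold truncatedPowerSum
  fun_prop

theorem hasDerivAt_max_sub_pow (x : ℝ) (d : ℕ) (y : ℝ) :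
    HasDerivAt (fun y => max (y - x) 0 ^ (d + 2)) ((d + 2) * max (y - x) 0 ^ (d + 1)) y := by
  refine hasDerivAt_of_hasDerivAt_of_ne' (x := x)
    (g := fun y => ((d : ℝ) + 2) * max (y - x) 0 ^ (d + 1)) (fun z hz => ?_)
    (by fun_prop) (by fun_prop) y
  rcases lt_or_gt_of_ne hz with hlt | hgt
  · have h0 : max (z - x) 0 = 0 := max_eq_right (by linarith)
    have : (fun y => max (y - x) 0 ^ (d + 2)) =ᶠ[nhds z] fun _ => (0 : ℝ) := by
      filter_upwards [Iio_mem_nhds hlt] with w hw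
      have hw' : max (w - x) 0 = 0 := max_eq_right (by linarith [Set.mem_Iio.1 hw])
      simp [hw']
    simpa [h0] using (hasDerivAt_const z (0 : ℝ)).congr_of_eventuallyEq this
  · have h0 : max (z - x) 0 = z - x := max_eq_left (by linarith)
    have : (fun y => max (y - x) 0 ^ (d + 2)) =ᶠ[nhds z] fun y => (y - x) ^ (d + 2) := by
      filter_upwards [Ioi_mem_nhds hgt] with w hw
      have hw' : max (w - x) 0 = w - x := max_eq_left (by linarith [Set.mem_Ioi.1 hw])
      simp [hw']
    have h := ((hasDerivAt_id z).sub_const x).pow (d + 2)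
    simp only [id_eq, Nat.cast_add, Nat.cast_ofNat, mul_one] at h
    simp only [h0]
    exact h.congr_of_eventuallyEq this

theorem hasDerivAt_truncatedPowerSum {ι : Type*} (I : Finset ι) (X c : ι → ℝ) (a : ℝ) (d : ℕ)
    (y : ℝ) :
    HasDerivAt (truncatedPowerSum I X c a (d + 2))
      (truncatedPowerSum I X (fun i => c i * (d + 2)) (a * (d + 3)) (d + 1) y) y := by
  unfold truncatedPowerSum
  have h1 := (hasDerivAt_pow (d + 3) y).const_mul a
  have h2 := HasDerivAt.fun_sum fun i (_ : i ∈ I) =>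
    (hasDerivAt_max_sub_pow (X i) d y).const_mul (c i)
  refine (h1.fun_sub h2).congr_deriv ?_
  push_cast
  congr 1
  · ring
  · exact Finset.sum_congr rfl fun i _ => by ring

/-- A piecewise quadratic function with `m` knots and the same nonzero leading coefficient on each
piece has at most `2 * m` positive zeros if it is a pure square before the first knot. -/
theorem card_zeros_truncatedPowerSum_one_le {ι : Type*} (I : Finset ι) (X c : ι → ℝ) {a : ℝ}
    (ha : a ≠ 0) (S : Finset ℝ) (hS : ∀ y ∈ S, 0 < y ∧ truncatedPowerSum I X c a 1 y = 0) :
    S.card ≤ 2 * I.card := by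
  classical
  have key : ∀ y, truncatedPowerSum I X c a 1 y = a * y ^ 2 - ∑ i ∈ I with X i < y,
      c i * (y - X i) := by
    intro y
    rw [truncatedPowerSum, Finset.sum_filter]
    congr 1
    refine Finset.sum_congr rfl fun i _ => ?_
    split_ifs with h
    · rw [max_eq_left (by linarith), pow_one]
    · rw [max_eq_right (by linarith), pow_one, mul_zero]
  have hmono : ∀ x y, x ≤ y → I.filter (X · < x) ⊆ I.filter (X · < y) := fun x y hxy i hi => by
    rw [Finset.mem_filter] at hi ⊢
    exact ⟨hi.1, hi.2.trans_le hxy⟩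
  have hsame : ∀ x y, (I.filter (X · < x)).card = (I.filter (X · < y)).card →
      I.filter (X · < x) = I.filter (X · < y) := by
    intro x y h
    rcases le_total x y with hxy | hxy
    · exact Finset.eq_of_subset_of_card_le (hmono x y hxy) h.ge
    · exact (Finset.eq_of_subset_of_card_le (hmono y x hxy) h.le).symm
  have hmaps : ∀ y ∈ S, (I.filter (X · < y)).card ∈ Finset.Icc 1 I.card := by
    intro y hy
    obtain ⟨hy0, hy1⟩ := hS y hy
    refine Finset.mem_Icc.2 ⟨?_, Finset.card_filter_le _ _⟩
    by_contra hlt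
    rw [not_le, Nat.lt_one_iff, Finset.card_eq_zero] at hlt
    rw [key, hlt, Finset.sum_empty, sub_zero] at hy1
    exact mul_ne_zero ha (by positivity) hy1
  have := Finset.card_le_mul_card_image_of_maps_to hmaps 2 fun b _ => by
    by_contra! hcard
    obtain ⟨x, hx, y, hy, z, hz, hxy, hxz, hyz⟩ := Finset.two_lt_card.1 hcard
    rw [Finset.mem_filter] at hx hy hz
    have ex := (hS x hx.1).2
    have ey := (hS y hy.1).2
    have ez := (hS z hz.1).2
    rw [key] at ex ey ez
    rw [hsame y x (hy.2.trans hx.2.symm)] at ey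
    rw [hsame z x (hz.2.trans hx.2.symm)] at ez
    simp only [mul_sub, Finset.sum_sub_distrib, ← Finset.sum_mul] at ex ey ez
    have e1 : (x - y) * (a * (x + y) - ∑ i ∈ I with X i < x, c i) = 0 := by
      linear_combination ex - ey
    have e2 : (x - z) * (a * (x + z) - ∑ i ∈ I with X i < x, c i) = 0 := by
      linear_combination ex - ez
    have f1 := (mul_eq_zero.1 e1).resolve_left (sub_ne_zero.2 hxy)
    have f2 := (mul_eq_zero.1 e2).resolve_left (sub_ne_zero.2 hxz)
    have f3 : a * (y - z) = 0 := by linear_combination f1 - f2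
    exact mul_ne_zero ha (sub_ne_zero.2 hyz) f3
  simpa using this

theorem card_zeros_truncatedPowerSum_le {ι : Type*} (I : Finset ι) (X : ι → ℝ)
    (hX : ∀ i ∈ I, 0 < X i) (d : ℕ) (c : ι → ℝ) {a : ℝ} (ha : a ≠ 0) (S : Finset ℝ)
    (hS : ∀ y ∈ S, 0 < y ∧ truncatedPowerSum I X c a (d + 1) y = 0) :
    S.card ≤ 2 * I.card := by
  induction d generalizing c a S with
  | zero => exact card_zeros_truncatedPowerSum_one_le I X c ha S hS
  | succ d ih =>
    obtain ⟨hfin, hcard⟩ := Set.finite_and_ncard_le_of_forall_finset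
      (s := {y | 0 < y ∧
        truncatedPowerSum I X (fun i => c i * (d + 2)) (a * (d + 3)) (d + 1) y = 0})
      fun T hT => ih _ (mul_ne_zero ha (by positivity)) T hT
    rw [Set.ncard_eq_toFinset_card _ hfin] at hcard
    have h0 : truncatedPowerSum I X c a (d + 2) 0 = 0 := by
      unfold truncatedPowerSum
      rw [Finset.sum_eq_zero fun i hi => ?_]
      · simp
      · rw [max_eq_right (by linarith [hX i hi])]
        simp
    have hzero : ∀ y ∈ insert 0 S, 0 ≤ y ∧ truncatedPowerSum I X c a (d + 2) y = 0 := by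
      intro y hy
      rcases Finset.mem_insert.1 hy with rfl | hy
      · exact ⟨le_rfl, h0⟩
      · exact ⟨(hS y hy).1.le, (hS y hy).2⟩
    have hle : (insert 0 S).card ≤ hfin.toFinset.card + 1 := by
      refine Finset.card_le_of_interleaved fun x hx y hy hxy _ => ?_
      obtain ⟨z, hz, hz0⟩ := exists_hasDerivAt_eq_zero hxy
        (continuous_truncatedPowerSum I X c a (d + 2)).continuousOn
        ((hzero x hx).2.trans (hzero y hy).2.symm)
        fun w _ => hasDerivAt_truncatedPowerSum I X c a d w
      exact ⟨z, hfin.mem_toFinset.2 ⟨(hzero x hx).1.trans_lt hz.1, hz0⟩, hz.1, hz.2⟩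
    rw [Finset.card_insert_of_notMem fun h => lt_irrefl _ (hS 0 h).1] at hle
    omega

/-- If `f ≥ 0` has finitely many positive zeros, then subtracting a small multiple of a positive
function splits each of them into two zeros. -/
theorem exists_perturbation_zeros {f g : ℝ → ℝ} (hf : Continuous f) (hg : Continuous g)
    (hf0 : ∀ y, 0 < y → 0 ≤ f y) (hg0 : ∀ y, 0 < y → 0 < g y)
    (hfin : {y | 0 < y ∧ f y = 0}.Finite) (S : Finset ℝ) (hS : ∀ y ∈ S, 0 < y ∧ f y = 0) :
    ∃ ε : ℝ, ε < 1 ∧ ∃ T : Finset ℝ, T.card = 2 * S.card ∧ ∀ y ∈ T, 0 < y ∧ f y - ε * g y = 0 := by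
  classical
  obtain ⟨U, hU, hdisj⟩ := S.finite_toSet.t2_separation
  have hpos : ∀ a b : ℝ, 0 < a → a < b → ∃ q ∈ Ioo a b, 0 < f q := by
    intro a b ha hab
    obtain ⟨q, hq, hqf⟩ := (Ioo_infinite hab).exists_notMem_finite hfin
    have hq0 : 0 < q := ha.trans hq.1
    exact ⟨q, hq, (hf0 q hq0).lt_of_ne fun h => hqf ⟨hq0, h.symm⟩⟩
  have hnbr : ∀ s ∈ S, ∃ l r, 0 < l ∧ l < s ∧ s < r ∧ Icc l r ⊆ U s ∧ 0 < f l ∧ 0 < f r := by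
    intro s hs
    have hmem : U s ∩ Ioi 0 ∈ nhds s :=
      Filter.inter_mem ((hU s).2.mem_nhds (hU s).1) (Ioi_mem_nhds (hS s hs).1)
    obtain ⟨b, c, hbc, hsub⟩ := mem_nhds_iff_exists_Ioo_subset.1 hmem
    obtain ⟨a, hba, has⟩ := exists_between hbc.1
    obtain ⟨l, hl, hlf⟩ := hpos a s (hsub ⟨hba, has.trans hbc.2⟩).2 has
    obtain ⟨r, hr, hrf⟩ := hpos s c (hS s hs).1 hbc.2
    exact ⟨l, r, (hsub ⟨hba.trans hl.1, hl.2.trans hbc.2⟩).2, hl.2, hr.1,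
      fun y hy => (hsub ⟨(hba.trans hl.1).trans_le hy.1, hy.2.trans_lt hr.2⟩).1, hlf, hrf⟩
  choose! l r hl0 hls hsr hsub hfl hfr using hnbr
  have hsmall : ∀ q, 0 < f q → ∀ᶠ ε in nhds (0 : ℝ), 0 < f q - ε * g q := fun q hq =>
    (show Continuous fun ε : ℝ => f q - ε * g q by fun_prop).continuousAt.eventually_const_lt
      (by simpa using hq)
  have hev : ∀ᶠ ε in nhdsWithin (0 : ℝ) (Ioi 0), 0 < ε ∧ ε < 1 ∧
      ∀ s ∈ S, 0 < f (l s) - ε * g (l s) ∧ 0 < f (r s) - ε * g (r s) := by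
    refine eventually_mem_nhdsWithin.and
      (((eventually_lt_nhds one_pos).filter_mono nhdsWithin_le_nhds).and ?_)
    refine ((Filter.eventually_all_finset S).2 fun s hs => ?_).filter_mono nhdsWithin_le_nhds
    exact (hsmall _ (hfl s hs)).and (hsmall _ (hfr s hs))
  obtain ⟨ε, hε, hε1, hq⟩ := hev.exists
  refine ⟨ε, hε1, ?_⟩
  have hcont : Continuous fun y => f y - ε * g y := by fun_prop
  have hz : ∀ s ∈ S, ∃ z w, l s < z ∧ z < s ∧ s < w ∧ w < r s ∧
      f z - ε * g z = 0 ∧ f w - ε * g w = 0 := by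
    intro s hs
    have hneg : f s - ε * g s < 0 := by
      rw [(hS s hs).2, zero_sub, neg_lt_zero]
      exact mul_pos hε (hg0 s (hS s hs).1)
    obtain ⟨z, hz, hz0⟩ := intermediate_value_Ioo' (hls s hs).le hcont.continuousOn
      ⟨hneg, (hq s hs).1⟩
    obtain ⟨w, hw, hw0⟩ := intermediate_value_Ioo (hsr s hs).le hcont.continuousOn
      ⟨hneg, (hq s hs).2⟩
    exact ⟨z, w, hz.1, hz.2, hw.1, hw.2, hz0, hw0⟩
  choose! z w hlz hzs hsw hwr hz0 hw0 using hz
  refine ⟨S.biUnion fun s => {z s, w s}, ?_, fun y hy => ?_⟩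
  · rw [Finset.card_biUnion, Finset.sum_congr rfl fun s hs =>
      Finset.card_pair ((hzs s hs).trans (hsw s hs)).ne, Finset.sum_const, smul_eq_mul, mul_comm]
    have hpair : ∀ s ∈ S, ∀ y ∈ ({z s, w s} : Finset ℝ), y ∈ U s := by
      intro s hs y hy
      refine hsub s hs ?_
      have := hlz s hs
      have := hzs s hs
      have := hsw s hs
      have := hwr s hs
      rcases Finset.mem_insert.1 hy with rfl | hy
      · exact ⟨by linarith, by linarith⟩
      · rw [Finset.mem_singleton.1 hy]
        exact ⟨by linarith, by linarith⟩
    intro s hs t ht hst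
    refine Finset.disjoint_left.2 fun y hy hy' => ?_
    exact Set.disjoint_left.1 (hdisj hs ht hst) (hpair s hs y hy) (hpair t ht y hy')
  · obtain ⟨s, hs, hy⟩ := Finset.mem_biUnion.1 hy
    have h1 := (hl0 s hs).trans (hlz s hs)
    rcases Finset.mem_insert.1 hy with rfl | hy
    · exact ⟨h1, hz0 s hs⟩
    · rw [Finset.mem_singleton.1 hy]
      exact ⟨h1.trans ((hzs s hs).trans (hsw s hs)), hw0 s hs⟩

theorem card_zeros_truncatedPowerSum_le_of_nonneg {ι : Type*} (I : Finset ι) (X c : ι → ℝ)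
    (hX : ∀ i ∈ I, 0 < X i) (d : ℕ)
    (hnn : ∀ y, 0 < y → 0 ≤ truncatedPowerSum I X c 1 (d + 1) y) (S : Finset ℝ)
    (hS : ∀ y ∈ S, 0 < y ∧ truncatedPowerSum I X c 1 (d + 1) y = 0) :
    S.card ≤ I.card := by
  have hfin := (Set.finite_and_ncard_le_of_forall_finset
    (s := {y | 0 < y ∧ truncatedPowerSum I X c 1 (d + 1) y = 0})
    fun T hT => card_zeros_truncatedPowerSum_le I X hX d c one_ne_zero T hT).1
  obtain ⟨ε, hε, T, hTc, hT⟩ := exists_perturbation_zeros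
    (continuous_truncatedPowerSum I X c 1 (d + 1)) (continuous_pow (d + 2)) hnn
    (fun y hy => pow_pos hy _) hfin S hS
  have := card_zeros_truncatedPowerSum_le I X hX d c (sub_pos.2 hε).ne' T fun y hy => by
    refine ⟨(hT y hy).1, ?_⟩
    rw [← (hT y hy).2, truncatedPowerSum, truncatedPowerSum]
    ring
  omega

/-- Let `k ≥ 2`, `0 < X₁ < … < X_n`, `v₁, …, v_n > 0`, and suppose
`p(y) = y^k - ∑ᵢ vᵢ (y - Xᵢ)₊^{k-1}` is nonnegative on `[0, ∞)`.  Let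
`Y = {y > 0 : p(y) = 0}`.  Then for each `j` (1-indexed; here `j : Fin n`, so the
1-indexed index is `j.val + 1`), `Y` has at most `j - 1 = j.val` points in `(0, X_j]`;
in particular `Y` is finite with at most `n` elements, and if `Y = {Y₁ < … < Y_m}` then
`Y_j > X_j` for all `j ≤ m`. -/
theorem zero_set_count (k n : ℕ) (hk : 2 ≤ k)
    (X : Fin n → ℝ) (hX : StrictMono X) (hXpos : ∀ i, 0 < X i)
    (v : Fin n → ℝ) (hv : ∀ i, 0 < v i)
    (p : ℝ → ℝ) (hp : ∀ y, p y = y ^ k - ∑ i, v i * max (y - X i) 0 ^ (k - 1))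
    (hpnonneg : ∀ y ≥ 0, 0 ≤ p y)
    (Y : Set ℝ) (hY : Y = {y | 0 < y ∧ p y = 0}) :
    (∀ j : Fin n, (Y ∩ Ioc 0 (X j)).Finite ∧ (Y ∩ Ioc 0 (X j)).ncard ≤ j.val) ∧
    Y.Finite ∧ Y.ncard ≤ n ∧
    ∀ (m : ℕ) (Z : Fin m → ℝ), StrictMono Z → range Z = Y →
      ∀ j : Fin m, ∀ h : j.val < n, X ⟨j.val, h⟩ < Z j := by
  obtain ⟨d, rfl⟩ : ∃ d, k = d + 2 := ⟨k - 2, by omega⟩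
  have hp' : ∀ y, p y = truncatedPowerSum Finset.univ X v 1 (d + 1) y := fun y => by
    rw [hp, truncatedPowerSum, one_mul]
    rfl
  have hsplit : ∀ j y, truncatedPowerSum (Finset.Iio j) X v 1 (d + 1) y =
      p y + ∑ i ∈ (Finset.Iio j)ᶜ, v i * max (y - X i) 0 ^ (d + 1) := fun j y => by
    rw [hp', truncatedPowerSum, truncatedPowerSum, ← Finset.sum_add_sum_compl (Finset.Iio j)]
    ring
  have hcount : ∀ j : Fin n, ∀ S : Finset ℝ, (∀ y ∈ S, y ∈ Y ∩ Ioc 0 (X j)) →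
      S.card ≤ j.val := by
    intro j S hS
    rw [← Fin.card_Iio]
    refine card_zeros_truncatedPowerSum_le_of_nonneg _ X v (fun i _ => hXpos i) d
      (fun y hy => ?_) S fun y hy => ?_
    · rw [hsplit]
      exact add_nonneg (hpnonneg y hy.le) (Finset.sum_nonneg fun i _ =>
        mul_nonneg (hv i).le (pow_nonneg (le_max_right _ _) _))
    · obtain ⟨hyY, hy0, hyX⟩ := hS y hy
      rw [hY] at hyY
      refine ⟨hy0, ?_⟩
      rw [hsplit, hyY.2, zero_add]
      refine Finset.sum_eq_zero fun i hi => ?_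
      have hji : j ≤ i := by simpa using hi
      rw [max_eq_right (by linarith [hX.monotone hji]), zero_pow d.succ_ne_zero, mul_zero]
  have hall := Set.finite_and_ncard_le_of_forall_finset (s := Y) (N := n) fun S hS => by
    have := card_zeros_truncatedPowerSum_le_of_nonneg Finset.univ X v (fun i _ => hXpos i) d
      (fun y hy => hp' y ▸ hpnonneg y hy.le) S fun y hy => by
        have := hS y hy
        rw [hY] at this
        exact ⟨this.1, hp' y ▸ this.2⟩
    simpa using this
  refine ⟨fun j => Set.finite_and_ncard_le_of_forall_finset (hcount j), hall.1, hall.2, ?_⟩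
  intro m Z hZ hrange j h
  by_contra! hle
  have := hcount ⟨j, h⟩ ((Finset.Iic j).image Z) fun y hy => by
    obtain ⟨i, hi, rfl⟩ := Finset.mem_image.1 hy
    have hiY : Z i ∈ Y := hrange ▸ Set.mem_range_self i
    have hi0 : 0 < Z i := by
      rw [hY] at hiY
      exact hiY.1
    exact ⟨hiY, hi0, (hZ.monotone (Finset.mem_Iic.1 hi)).trans hle⟩
  rw [Finset.card_image_of_injective _ hZ.injective, Fin.card_Iic] at this
  simp at this
end

section
/- There exists a probability measure Ĝ on (0, ∞) that is a maximum likelihood estimator, i.e., L(Ĝ) ≥ L(G) for all probability measures G on (0, ∞); moreover Ĝ can be chosen to be a discrete measure supported on at most n points. -/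
open Set MeasureTheory

/-- The `k`-monotone mixture density `f_G(x) = ∫ k (y - x)₊^{k-1} / y^k dG(y)`. -/
noncomputable def mixDens (k : ℕ) (G : Measure ℝ) (x : ℝ) : ℝ :=
  ∫ y, (k : ℝ) * max (y - x) 0 ^ (k - 1) / y ^ k ∂G

/-- The likelihood of the mixing measure `G` given observations `X₁, …, X_n`. -/
noncomputable def lik (k n : ℕ) (X : Fin n → ℝ) (G : Measure ℝ) : ℝ :=
  ∏ i, mixDens k G (X i)

/-- In a finite-dimensional space, the convex hull of a compact set is compact. -/
theorem isCompact_convexHull_of_finiteDimensional {E : Type*} [NormedAddCommGroup E]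
    [NormedSpace ℝ E] [FiniteDimensional ℝ E] {K : Set E} (hK : IsCompact K) :
    IsCompact (convexHull ℝ K) := by
  obtain rfl | ⟨z₀, hz₀⟩ := K.eq_empty_or_nonempty
  · simp
  let d := Module.finrank ℝ E + 1
  let T : Set ((Fin d → ℝ) × (Fin d → E)) := stdSimplex ℝ (Fin d) ×ˢ univ.pi fun _ => K
  have hT : IsCompact T := (isCompact_stdSimplex ℝ (Fin d)).prod (isCompact_univ_pi fun _ => hK)
  have himage : convexHull ℝ K =
      (fun q : (Fin d → ℝ) × (Fin d → E) => ∑ j, q.1 j • q.2 j) '' T := by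
    apply Subset.antisymm
    · intro x hx
      obtain ⟨ι, _, z, w, hz, hind, hw, hw1, rfl⟩ := eq_pos_convex_span_of_mem_convexHull hx
      have hcard : Fintype.card ι ≤ Fintype.card (Fin d) := by
        rw [Fintype.card_fin]
        exact hind.card_le_finrank_succ.trans (Nat.succ_le_succ (Submodule.finrank_le _))
      obtain ⟨e⟩ := Function.Embedding.nonempty_of_card_le hcard
      have hext (i : ι) : Function.extend e w 0 (e i) = w i := e.injective.extend_apply ..
      have hext' (j : Fin d) (hj : j ∉ range e) : Function.extend e w 0 j = 0 :=
        Function.extend_apply' _ _ _ fun ⟨i, hi⟩ => hj ⟨i, hi⟩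
      refine ⟨(Function.extend e w 0, Function.extend e z fun _ => z₀), ⟨⟨fun j => ?_, ?_⟩, ?_⟩, ?_⟩
      · by_cases hj : j ∈ range e
        · obtain ⟨i, rfl⟩ := hj
          simpa [hext] using (hw i).le
        · simp [hext' j hj]
      · rw [← hw1]
        exact (Fintype.sum_of_injective e e.injective _ _ hext' fun i => (hext i).symm).symm
      · intro j _
        by_cases hj : j ∈ range e
        · obtain ⟨i, rfl⟩ := hj
          simpa [e.injective.extend_apply] using hz ⟨i, rfl⟩
        · simpa [Function.extend_apply' _ _ _ (show ¬∃ i, e i = j from hj)] using hz₀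
      · refine (Fintype.sum_of_injective e e.injective _ _ (fun j hj => ?_) fun i => ?_).symm
        · simp [hext' j hj]
        · simp [e.injective.extend_apply]
    · rintro _ ⟨q, ⟨⟨hw, hw1⟩, hz⟩, rfl⟩
      exact (convex_convexHull ℝ K).sum_mem (fun j _ => hw j) hw1
        fun j _ => subset_convexHull ℝ K (hz j trivial)
  rw [himage]
  exact hT.image (by fun_prop)

/-- A convex combination of `finrank + 1` affinely independent points with positive weights is
interior, so it can be scaled up inside any convex set containing the points. -/
theorem exists_one_lt_smul_mem_of_card_eq {E : Type*} [NormedAddCommGroup E]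
    [NormedSpace ℝ E] [FiniteDimensional ℝ E] {s : Set E} {ι : Type*} [Fintype ι]
    {z : ι → E} {w : ι → ℝ} (hz : range z ⊆ s) (hind : AffineIndependent ℝ z)
    (hw : ∀ i, 0 < w i) (hw1 : ∑ i, w i = 1) (hcard : Fintype.card ι = Module.finrank ℝ E + 1) :
    ∃ t : ℝ, 1 < t ∧ t • ∑ i, w i • z i ∈ convexHull ℝ s := by
  set x := ∑ i, w i • z i
  let b : AffineBasis ι ℝ E :=
    ⟨z, hind, hind.affineSpan_eq_top_iff_card_eq_finrank_add_one.2 hcard⟩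
  have hxb : x = Finset.univ.affineCombination ℝ b w := by
    rw [Finset.affineCombination_eq_linear_combination _ _ _ hw1]
    rfl
  have hxint : x ∈ interior (convexHull ℝ (range z)) := by
    have : x ∈ {x | ∀ i, 0 < b.coord i x} := fun i => by
      rw [hxb, b.coord_apply_combination_of_mem (Finset.mem_univ i) hw1]
      exact hw i
    rwa [← b.interior_convexHull] at this
  have hcont : Filter.Tendsto (fun t : ℝ => t • x) (nhds 1) (nhds x) := by
    simpa using (show Continuous fun t : ℝ => t • x by fun_prop).tendsto 1
  have hev : ∀ᶠ t in nhds (1 : ℝ), t • x ∈ convexHull ℝ s := by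
    filter_upwards [hcont (mem_interior_iff_mem_nhds.1 hxint)] with t ht
    exact convexHull_mono hz ht
  obtain ⟨t, ht, ht1⟩ :=
    ((hev.filter_mono nhdsWithin_le_nhds).and (self_mem_nhdsWithin : Ioi (1 : ℝ) ∈ _)).exists
  exact ⟨t, ht1, ht⟩

/-- The scale mixture kernel `k (y - x)₊^{k-1} / y^k`. -/
noncomputable def mixKernel (k : ℕ) (x y : ℝ) : ℝ :=
  (k : ℝ) * max (y - x) 0 ^ (k - 1) / y ^ k

theorem mixKernel_eq_zero {k : ℕ} (hk : 2 ≤ k) {x y : ℝ} (h : y ≤ x) : mixKernel k x y = 0 := by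
  simp [mixKernel, max_eq_right (sub_nonpos.2 h), show k - 1 ≠ 0 by omega]

theorem mixKernel_pos {k : ℕ} (hk : 2 ≤ k) {x y : ℝ} (hx : 0 < x) (h : x < y) :
    0 < mixKernel k x y := by
  have : 0 < y := hx.trans h
  have : 0 < max (y - x) 0 := lt_max_of_lt_left (sub_pos.2 h)
  have : (0 : ℝ) < k := by exact_mod_cast (by omega : 0 < k)
  unfold mixKernel
  positivity

theorem continuous_mixKernel {k : ℕ} (hk : 2 ≤ k) {x : ℝ} (hx : 0 < x) :
    Continuous (mixKernel k x) := by
  refine continuous_iff_continuousAt.2 fun y => ?_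
  obtain hy | hy := lt_or_ge 0 y
  · have := hy.ne'
    unfold mixKernel
    fun_prop (disch := positivity)
  · refine ContinuousAt.congr (f := fun _ => (0 : ℝ)) continuousAt_const ?_
    filter_upwards [Iio_mem_nhds (hy.trans_lt hx)] with u hu
    exact (mixKernel_eq_zero hk (le_of_lt hu)).symm

theorem abs_mixKernel_le {k : ℕ} (hk : 2 ≤ k) {x : ℝ} (hx : 0 < x) (y : ℝ) :
    |mixKernel k x y| ≤ k * |y⁻¹| := by
  obtain hy | hy := le_or_gt y x
  · rw [mixKernel_eq_zero hk hy]
    simp only [abs_zero]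
    positivity
  have hy0 : 0 < y := hx.trans hy
  rw [abs_of_pos (mixKernel_pos hk hx hy), abs_of_pos (inv_pos.2 hy0), mixKernel,
    max_eq_left (sub_pos.2 hy).le, mul_div_assoc]
  gcongr
  obtain ⟨m, rfl⟩ : ∃ m, k = m + 1 := ⟨k - 1, by omega⟩
  rw [Nat.add_sub_cancel, div_le_iff₀ (by positivity), pow_succ', inv_mul_cancel_left₀ hy0.ne']
  exact pow_le_pow_left₀ (sub_pos.2 hy).le (by linarith) m

theorem tendsto_mixKernel_cocompact {k : ℕ} (hk : 2 ≤ k) {x : ℝ} (hx : 0 < x) :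
    Filter.Tendsto (mixKernel k x) (Filter.cocompact ℝ) (nhds 0) := by
  refine squeeze_zero_norm (abs_mixKernel_le hk hx) ?_
  have h := (Filter.tendsto_inv₀_cobounded (α := ℝ)).abs.const_mul (k : ℝ)
  rw [abs_zero, mul_zero, Metric.cobounded_eq_cocompact] at h
  exact h

/-- There exists a probability measure `Ĝ` on `(0, ∞)` that is a maximum likelihood
estimator, and it can be chosen to be discrete, supported on at most `n` points. -/
theorem mle_exists (k n : ℕ) (hk : 2 ≤ k) (hn : 1 ≤ n)
    (X : Fin n → ℝ) (hX : StrictMono X) (hXpos : ∀ i, 0 < X i) :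
    ∃ G : Measure ℝ, IsProbabilityMeasure G ∧ G (Iic 0) = 0 ∧
      (∀ G' : Measure ℝ, IsProbabilityMeasure G' → G' (Iic 0) = 0 →
        lik k n X G' ≤ lik k n X G) ∧
      ∃ S : Finset ℝ, S.card ≤ n ∧ G (↑S : Set ℝ)ᶜ = 0 := by
  have : Nonempty (Fin n) := ⟨⟨0, hn⟩⟩
  let Φ : ℝ → Fin n → ℝ := fun y i => mixKernel k (X i) y
  have hΦ : Continuous Φ := continuous_pi fun i => continuous_mixKernel hk (hXpos i)
  have hΦlim : Filter.Tendsto Φ (Filter.cocompact ℝ) (nhds 0) :=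
    tendsto_pi_nhds.2 fun i => tendsto_mixKernel_cocompact hk (hXpos i)
  obtain ⟨a, ha, hXa⟩ : ∃ a, 0 < a ∧ ∀ i, a ≤ X i := by
    obtain ⟨i, hi⟩ := Finite.exists_min X
    exact ⟨X i, hXpos i, hi⟩
  have hΦzero {y : ℝ} (hy : y ≤ a) : Φ y = 0 :=
    funext fun i => mixKernel_eq_zero hk (hy.trans (hXa i))
  have hK : IsCompact (range Φ) := by
    have := hΦlim.isCompact_insert_range_of_cocompact hΦ
    rwa [insert_eq_of_mem (show (0 : Fin n → ℝ) ∈ range Φ from ⟨a, hΦzero le_rfl⟩)] at this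
  have hC : IsCompact (convexHull ℝ (range Φ)) := isCompact_convexHull_of_finiteDimensional hK
  obtain ⟨p, hpC, hpmax⟩ := hC.exists_isMaxOn ⟨Φ a, subset_convexHull ℝ _ ⟨a, rfl⟩⟩
    (show Continuous fun v : Fin n → ℝ => ∏ i, v i by fun_prop).continuousOn
  have hppos : 0 < ∏ i, p i := by
    obtain ⟨j, hj⟩ := Finite.exists_max X
    refine lt_of_lt_of_le ?_ (hpmax (subset_convexHull ℝ _ (mem_range_self (X j + 1))))
    exact Finset.prod_pos fun i _ => mixKernel_pos hk (hXpos i) ((hj i).trans_lt (lt_add_one _))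
  have hint (i : Fin n) (G : Measure ℝ) [IsFiniteMeasure G] :
      Integrable (mixKernel k (X i)) G := by
    obtain ⟨c, hc⟩ := hK.isBounded.exists_norm_le
    refine Integrable.of_bound (continuous_mixKernel hk (hXpos i)).aestronglyMeasurable c
      (Filter.Eventually.of_forall fun y => ?_)
    exact (norm_le_pi_norm (Φ y) i).trans (hc _ ⟨y, rfl⟩)
  have hle (G : Measure ℝ) (hG : IsProbabilityMeasure G) : lik k n X G ≤ ∏ i, p i := by
    have hmem : ∫ y, Φ y ∂G ∈ convexHull ℝ (range Φ) :=
      (convex_convexHull ℝ _).integral_mem hC.isClosed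
        (Filter.Eventually.of_forall fun y => subset_convexHull ℝ _ ⟨y, rfl⟩)
        (Integrable.of_eval fun i => hint i G)
    have h : ∏ i, (∫ y, Φ y ∂G) i ≤ ∏ i, p i := hpmax hmem
    exact (Finset.prod_congr rfl fun i _ =>
      (eval_integral (f := Φ) (fun i => hint i G) i).symm).trans_le h
  obtain ⟨ι, _, z, w, hz, hind, hw, hw1, hp⟩ := eq_pos_convex_span_of_mem_convexHull hpC
  have hcard : Fintype.card ι ≤ n := by
    have hle : Fintype.card ι ≤ n + 1 := by
      simpa using hind.card_le_finrank_succ.trans (Nat.succ_le_succ (Submodule.finrank_le _))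
    by_contra hlt
    obtain ⟨t, ht, htC⟩ := exists_one_lt_smul_mem_of_card_eq hz hind hw hw1
      (by rw [Module.finrank_fin_fun]; omega)
    rw [hp] at htC
    have h : ∏ i, (t • p) i ≤ ∏ i, p i := hpmax htC
    simp only [Pi.smul_apply, smul_eq_mul, Finset.prod_mul_distrib, Finset.prod_const,
      Finset.card_univ, Fintype.card_fin] at h
    exact h.not_gt (lt_mul_of_one_lt_left hppos (one_lt_pow₀ ht (by omega)))
  have hsupp (j : ι) : ∃ y, 0 < y ∧ Φ y = z j := by
    obtain ⟨y, hy⟩ := hz ⟨j, rfl⟩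
    obtain hya | hya := le_or_gt y a
    · exact ⟨a, ha, by rw [← hy, hΦzero hya, hΦzero le_rfl]⟩
    · exact ⟨y, ha.trans hya, hy⟩
  choose y hy0 hy using hsupp
  let G : Measure ℝ := ∑ j, ENNReal.ofReal (w j) • Measure.dirac (y j)
  have hG : IsProbabilityMeasure G := ⟨by
    simp [G, ← ENNReal.ofReal_sum_of_nonneg fun j _ => (hw j).le, hw1]⟩
  have hdens (i : Fin n) : mixDens k G (X i) = p i := by
    change ∫ u, mixKernel k (X i) u ∂G = p i
    rw [integral_finsetSum_measure fun j _ => (hint i _).smul_measure ENNReal.ofReal_ne_top, ← hp]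
    simp [integral_smul_measure, ENNReal.toReal_ofReal (hw _).le, ← hy, Φ]
  refine ⟨G, hG, ?_, fun G' hG' _ => ?_, Finset.univ.image y, ?_, ?_⟩
  · simp [G, hy0]
  · simpa only [lik, hdens] using hle G' hG'
  · exact Finset.card_image_le.trans hcard
  · simp [G]
end

section
/- If Ĝ₁ and Ĝ₂ are both maximum likelihood estimators, then f_{Ĝ₁}(X_i) = f_{Ĝ₂}(X_i) for every i = 1, …, n; that is, the vector of fitted values (f_{Ĝ}(X₁), …, f_{Ĝ}(X_n)) is the same for all MLEs, and all its coordinates are strictly positive. -/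
open Set MeasureTheory

/-- `G` is a maximum likelihood estimator: a probability measure on `(0, ∞)` whose
likelihood is at least that of any other probability measure on `(0, ∞)`. -/
def IsMLE (k n : ℕ) (X : Fin n → ℝ) (G : Measure ℝ) : Prop :=
  IsProbabilityMeasure G ∧ G (Iic 0) = 0 ∧
    ∀ G' : Measure ℝ, IsProbabilityMeasure G' → G' (Iic 0) = 0 →
      lik k n X G' ≤ lik k n X G

/-- The mixture kernel is nonnegative. -/
lemma mixKernel_nonneg (k : ℕ) (hk : 2 ≤ k) {x : ℝ} (hx : 0 < x) (y : ℝ) :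
    0 ≤ (k : ℝ) * max (y - x) 0 ^ (k - 1) / y ^ k := by
  rcases le_or_gt y x with h | h
  · rw [max_eq_right (by linarith), zero_pow (by omega)]
    simp
  · have hy : 0 < y := hx.trans h
    positivity

/-- The mixture kernel at `x > 0` is bounded by `k / x`. -/
lemma mixKernel_le (k : ℕ) (hk : 2 ≤ k) {x : ℝ} (hx : 0 < x) (y : ℝ) :
    (k : ℝ) * max (y - x) 0 ^ (k - 1) / y ^ k ≤ k / x := by
  rcases le_or_gt y x with h | h
  · rw [max_eq_right (by linarith), zero_pow (by omega)]
    simp only [mul_zero, zero_div]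
    positivity
  · have hy : 0 < y := hx.trans h
    rw [max_eq_left (by linarith), mul_div_assoc, div_eq_mul_inv (k : ℝ)]
    refine mul_le_mul_of_nonneg_left ?_ (Nat.cast_nonneg k)
    have hpow : (y - x) ^ (k - 1) ≤ y ^ (k - 1) :=
      pow_le_pow_left₀ (by linarith) (by linarith) _
    have hsplit : y ^ k = y ^ (k - 1) * y := by
      rw [← pow_succ, Nat.sub_add_cancel (by omega)]
    rw [div_le_iff₀ (by positivity), hsplit]
    calc (y - x) ^ (k - 1) ≤ y ^ (k - 1) * 1 := by simpa using hpow
      _ ≤ y ^ (k - 1) * (x⁻¹ * y) := by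
          refine mul_le_mul_of_nonneg_left ?_ (by positivity)
          rw [inv_mul_eq_div, le_div_iff₀ hx]
          linarith
      _ = x⁻¹ * (y ^ (k - 1) * y) := by ring

lemma integrable_mixKernel (k : ℕ) (hk : 2 ≤ k) {x : ℝ} (hx : 0 < x)
    (G : Measure ℝ) [IsFiniteMeasure G] :
    Integrable (fun y : ℝ => (k : ℝ) * max (y - x) 0 ^ (k - 1) / y ^ k) G := by
  refine Integrable.of_bound (C := k / x) ?_ (Filter.Eventually.of_forall fun y => ?_)
  · exact Measurable.aestronglyMeasurable (by fun_prop)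
  · rw [Real.norm_of_nonneg (mixKernel_nonneg k hk hx y)]
    exact mixKernel_le k hk hx y

lemma mixDens_nonneg (k : ℕ) (hk : 2 ≤ k) {x : ℝ} (hx : 0 < x) (G : Measure ℝ) :
    0 ≤ mixDens k G x :=
  integral_nonneg (mixKernel_nonneg k hk hx)

/-- A point mass beyond all observations has positive likelihood. -/
lemma exists_lik_pos (k n : ℕ) (hk : 2 ≤ k) (X : Fin n → ℝ) :
    ∃ G : Measure ℝ, IsProbabilityMeasure G ∧ G (Iic 0) = 0 ∧ 0 < lik k n X G := by
  obtain ⟨M, hM⟩ := (Set.finite_range X).bddAbove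
  have hpos : 0 < max M 0 + 1 := by positivity
  refine ⟨Measure.dirac (max M 0 + 1), inferInstance, ?_, ?_⟩
  · rw [Measure.dirac_apply' _ measurableSet_Iic]
    simp [hpos]
  · refine Finset.prod_pos fun i _ => ?_
    have hi : X i < max M 0 + 1 :=
      ((hM ⟨i, rfl⟩).trans (le_max_left _ _)).trans_lt (lt_add_one _)
    have hmax : 0 < max (max M 0 + 1 - X i) 0 := lt_max_of_lt_left (by linarith)
    have hk' : (0 : ℝ) < k := by exact_mod_cast (by omega : 0 < k)
    rw [mixDens, integral_dirac]
    positivity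

/-- Fitted values of a maximum likelihood estimator are positive. -/
lemma IsMLE.mixDens_pos {k n : ℕ} (hk : 2 ≤ k) {X : Fin n → ℝ} (hXpos : ∀ i, 0 < X i)
    {G : Measure ℝ} (hG : IsMLE k n X G) (i : Fin n) : 0 < mixDens k G (X i) := by
  obtain ⟨G', hprob, hzero, hpos⟩ := exists_lik_pos k n hk X
  have hlik : 0 < lik k n X G := hpos.trans_le (hG.2.2 G' hprob hzero)
  exact (mixDens_nonneg k hk (hXpos i) G).lt_of_ne'
    (Finset.prod_ne_zero_iff.mp hlik.ne' i (Finset.mem_univ i))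

/-- The midpoint of two probability measures on `(0, ∞)` is again one, and its mixture density
is the midpoint of the two mixture densities. -/
lemma exists_midpoint_measure (k : ℕ) (hk : 2 ≤ k) (G₁ G₂ : Measure ℝ)
    [IsProbabilityMeasure G₁] [IsProbabilityMeasure G₂]
    (h₁ : G₁ (Iic 0) = 0) (h₂ : G₂ (Iic 0) = 0) :
    ∃ G : Measure ℝ, IsProbabilityMeasure G ∧ G (Iic 0) = 0 ∧
      ∀ x, 0 < x → mixDens k G x = (mixDens k G₁ x + mixDens k G₂ x) / 2 := by
  refine ⟨(2⁻¹ : ENNReal) • (G₁ + G₂), ⟨?_⟩, ?_, fun x hx => ?_⟩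
  · simp only [Measure.smul_apply, Measure.add_apply, measure_univ, smul_eq_mul]
    rw [one_add_one_eq_two]
    exact ENNReal.inv_mul_cancel (by simp) (by simp)
  · simp [h₁, h₂]
  · rw [mixDens, integral_smul_measure, integral_add_measure
      (integrable_mixKernel k hk hx G₁) (integrable_mixKernel k hk hx G₂)]
    simp only [mixDens, ENNReal.toReal_inv, ENNReal.toReal_ofNat, smul_eq_mul]
    ring

/-- Two positive vectors with equal products agree as soon as the product of their midpoints
does not exceed the common product. -/
lemma eq_of_prod_midpoint_le {ι : Type*} [Fintype ι] {a b : ι → ℝ}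
    (ha : ∀ i, 0 < a i) (hb : ∀ i, 0 < b i) (hab : ∏ i, a i = ∏ i, b i)
    (hmid : ∏ i, (a i + b i) / 2 ≤ ∏ i, a i) (j : ι) : a j = b j := by
  by_contra hne
  have hlt : ∏ i, a i * b i < ∏ i, ((a i + b i) / 2) ^ 2 := by
    refine Finset.prod_lt_prod (fun i _ => mul_pos (ha i) (hb i))
      (fun i _ => ?_) ⟨j, Finset.mem_univ j, ?_⟩
    · nlinarith [sq_nonneg (a i - b i)]
    · nlinarith [sq_pos_of_ne_zero (sub_ne_zero.mpr hne)]
  rw [Finset.prod_mul_distrib, Finset.prod_pow, ← hab, ← sq] at hlt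
  have hnonneg : 0 ≤ ∏ i, (a i + b i) / 2 :=
    Finset.prod_nonneg fun i _ => by linarith [ha i, hb i]
  exact hlt.not_ge (pow_le_pow_left₀ hnonneg hmid 2)

/-- Any two MLEs have the same vector of fitted values `(f_Ĝ(X₁), …, f_Ĝ(X_n))`,
and all coordinates of this vector are strictly positive. -/
theorem mle_fitted_values_unique (k n : ℕ) (hk : 2 ≤ k) (hn : 1 ≤ n)
    (X : Fin n → ℝ) (hX : StrictMono X) (hXpos : ∀ i, 0 < X i)
    (G₁ G₂ : Measure ℝ) (hG₁ : IsMLE k n X G₁) (hG₂ : IsMLE k n X G₂) :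
    (∀ i, mixDens k G₁ (X i) = mixDens k G₂ (X i)) ∧
    (∀ i, 0 < mixDens k G₁ (X i)) := by
  have hpos₁ := hG₁.mixDens_pos hk hXpos
  have hpos₂ := hG₂.mixDens_pos hk hXpos
  refine ⟨fun i => eq_of_prod_midpoint_le hpos₁ hpos₂ ?_ ?_ i, hpos₁⟩
  · exact le_antisymm (hG₂.2.2 G₁ hG₁.1 hG₁.2.1) (hG₁.2.2 G₂ hG₂.1 hG₂.2.1)
  · have := hG₁.1
    have := hG₂.1
    obtain ⟨G, hprob, hzero, hmid⟩ := exists_midpoint_measure k hk G₁ G₂ hG₁.2.1 hG₂.2.1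
    have hle := hG₁.2.2 G hprob hzero
    simpa only [lik, hmid _ (hXpos _)] using hle
end

section
/- Let k ≥ 2 be an integer, 0 < X₁ < X₂ < … < X_n, and Y₁ < Y₂ < … < Y_m with m ≤ n such that X_i < Y_i for all i ≤ m and Y_{i−k} < X_i whenever i − k ≥ 1. If real numbers s₁, …, s_m satisfy Σ_{j=1}^m s_j (Y_j − X_i)₊^{k−1} = 0 for every i = 1, …, n, then s₁ = s₂ = … = s_m = 0. -/
open Set

/-- The spline `∑ j ∈ S, s j * (Y j - x)₊ ^ q`, with the convention `t₊ ^ 0 = 0` for `t ≤ 0`. -/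
noncomputable def truncSpline (S : Finset ℕ) (s Y : ℕ → ℝ) (q : ℕ) (x : ℝ) : ℝ :=
  ∑ j ∈ S, if x < Y j then s j * (Y j - x) ^ q else 0

/-- There are `p` points `a ≤ x₁ ≤ … ≤ x_p` at which `f` is nonzero with alternating signs,
the sign of `f x₁` being that of `σ`. -/
def Alternates (f : ℝ → ℝ) : ℝ → ℝ → ℕ → Prop
  | _, _, 0 => True
  | σ, a, p + 1 => ∃ x, a ≤ x ∧ 0 < σ * f x ∧ Alternates f (-σ) x p

theorem Alternates.mono {f : ℝ → ℝ} {σ a b : ℝ} {p : ℕ} (h : Alternates f σ a p) (hba : b ≤ a) :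
    Alternates f σ b p := by
  cases p with
  | zero => trivial
  | succ p =>
    obtain ⟨x, hx, h⟩ := h
    exact ⟨x, hba.trans hx, h⟩

section

variable {S : Finset ℕ} {s Y : ℕ → ℝ} {q : ℕ}

theorem hasDerivWithinAt_truncSpline (x : ℝ) :
    HasDerivWithinAt (truncSpline S s Y (q + 1)) (-(q + 1) * truncSpline S s Y q x) (Ici x) x := by
  unfold truncSpline
  rw [Finset.mul_sum]
  refine HasDerivWithinAt.fun_sum fun j _ => ?_
  by_cases h : x < Y j
  · have h1 : HasDerivAt (fun y => s j * (Y j - y) ^ (q + 1))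
        (-(q + 1) * (s j * (Y j - x) ^ q)) x := by
      have := (((hasDerivAt_id x).const_sub (Y j)).pow (q + 1)).const_mul (s j)
      refine this.congr_deriv ?_
      simp
      ring
    rw [if_pos h]
    refine (h1.congr_of_eventuallyEq ?_).hasDerivWithinAt
    filter_upwards [Iio_mem_nhds h] with y hy
    exact if_pos hy
  · rw [if_neg h, mul_zero]
    refine (hasDerivWithinAt_const x (Ici x) (0 : ℝ)).congr (fun y hy => ?_) (if_neg h)
    exact if_neg (not_lt.2 ((not_lt.1 h).trans hy))

theorem continuous_truncSpline : Continuous (truncSpline S s Y (q + 1)) := by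
  have : truncSpline S s Y (q + 1) = fun x => ∑ j ∈ S, s j * max (Y j - x) 0 ^ (q + 1) := by
    funext x
    refine Finset.sum_congr rfl fun j _ => ?_
    split_ifs with h
    · rw [max_eq_left (by linarith)]
    · rw [max_eq_right (by linarith)]
      simp
  rw [this]
  fun_prop

theorem exists_pos_of_truncSpline_lt {σ x y : ℝ} (hxy : x ≤ y)
    (h : σ * truncSpline S s Y (q + 1) y < σ * truncSpline S s Y (q + 1) x) :
    ∃ z ∈ Icc x y, 0 < σ * truncSpline S s Y q z := by
  by_contra! hneg
  have key := image_le_of_deriv_right_le_deriv_boundary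
    (f := fun z => -σ * truncSpline S s Y (q + 1) z)
    (f' := fun z => -σ * (-(q + 1) * truncSpline S s Y q z)) (a := x) (b := y)
    (continuous_truncSpline.const_mul _ |>.continuousOn)
    (fun z _ => (hasDerivWithinAt_truncSpline z).const_mul _)
    (B := fun _ => -σ * truncSpline S s Y (q + 1) x) (B' := fun _ => 0) le_rfl
    continuousOn_const (fun z _ => hasDerivWithinAt_const _ _ _)
    (fun z hz => by
      have h1 := hneg z ⟨hz.1, hz.2.le⟩
      have h2 : (0 : ℝ) ≤ q + 1 := by positivity
      nlinarith [mul_nonneg h2 (neg_nonneg.2 h1)])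
    (right_mem_Icc.2 hxy)
  linarith

theorem truncSpline_eq_zero_of_le {x : ℝ} (h : ∀ j ∈ S, Y j ≤ x) : truncSpline S s Y q x = 0 :=
  Finset.sum_eq_zero fun j hj => if_neg (not_lt.2 (h j hj))

theorem truncSpline_eq_zero_of_succ {c : ℝ} (h : ∀ x < c, truncSpline S s Y (q + 1) x = 0) :
    ∀ x < c, truncSpline S s Y q x = 0 := by
  intro x hx
  have h1 := hasDerivWithinAt_truncSpline (S := S) (s := s) (Y := Y) (q := q) x
  have h2 : HasDerivWithinAt (truncSpline S s Y (q + 1)) 0 (Ici x) x := by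
    refine ((hasDerivAt_const x (0 : ℝ)).congr_of_eventuallyEq ?_).hasDerivWithinAt
    filter_upwards [Iio_mem_nhds hx] with y hy using h y hy
  have h3 := (uniqueDiffWithinAt_Ici x).eq_deriv _ h1 h2
  have h4 : (-((q : ℝ) + 1)) ≠ 0 := by
    have : (0 : ℝ) < q + 1 := by positivity
    linarith
  exact (mul_eq_zero.1 h3).resolve_left h4

theorem Alternates.pred {σ a : ℝ} {p : ℕ} (h : Alternates (truncSpline S s Y (q + 1)) σ a p) :
    Alternates (truncSpline S s Y q) σ a p := by
  induction p generalizing σ a with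
  | zero => trivial
  | succ p ih =>
    obtain ⟨x, hax, hx, h⟩ := h
    obtain ⟨y, hxy, hy, hg⟩ : ∃ y, x ≤ y ∧ σ * truncSpline S s Y (q + 1) y ≤ 0 ∧
        Alternates (truncSpline S s Y q) (-σ) y p := by
      cases p with
      | zero =>
        obtain ⟨T, hT⟩ := (S.image Y).bddAbove
        refine ⟨max x T, le_max_left _ _, ?_, trivial⟩
        rw [truncSpline_eq_zero_of_le fun j hj => (hT (by
          simpa using ⟨j, hj, rfl⟩)).trans (le_max_right _ _), mul_zero]
      | succ p =>
        obtain ⟨y, hxy, hy, h'⟩ := h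
        exact ⟨y, hxy, by linarith, ih (a := y) ⟨y, le_rfl, hy, h'⟩⟩
    obtain ⟨z, hz, hz'⟩ := exists_pos_of_truncSpline_lt hxy (hy.trans_lt hx)
    exact ⟨z, hax.trans hz.1, hz', hg.mono hz.2⟩

theorem Alternates.pred_of_eq_zero {σ a : ℝ} {p : ℕ}
    (h : Alternates (truncSpline S s Y (q + 1)) σ a (p + 1))
    (ha : truncSpline S s Y (q + 1) a = 0) :
    Alternates (truncSpline S s Y q) (-σ) a (p + 2) := by
  obtain ⟨x, hax, hx, h⟩ := h
  have hg : Alternates (truncSpline S s Y q) σ x (p + 1) :=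
    Alternates.pred ⟨x, le_rfl, hx, h⟩
  obtain ⟨z, hz, hz'⟩ := exists_pos_of_truncSpline_lt (σ := -σ) (S := S) (s := s) (Y := Y)
    (q := q) hax (by rw [ha]; linarith)
  exact ⟨z, hz.1, hz', by rw [neg_neg]; exact hg.mono hz.2⟩

theorem card_filter_lt_of_truncSpline_zero_ne {x y : ℝ} (hxy : x ≤ y)
    (h : truncSpline S s Y 0 x ≠ truncSpline S s Y 0 y) :
    (S.filter (y < Y ·)).card < (S.filter (x < Y ·)).card := by
  refine Finset.card_lt_card ((Finset.ssubset_iff_subset_ne).2 ⟨?_, fun he => h ?_⟩)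
  · exact Finset.monotone_filter_right _ fun j _ hj => hxy.trans_lt hj
  · simp only [truncSpline, pow_zero, ← Finset.sum_filter, he]

theorem Alternates.lt_card {σ x : ℝ} {p : ℕ} (hx : 0 < σ * truncSpline S s Y 0 x)
    (h : Alternates (truncSpline S s Y 0) (-σ) x p) :
    p < (S.filter (x < Y ·)).card := by
  induction p generalizing σ x with
  | zero =>
    refine Finset.card_pos.2 (Finset.nonempty_iff_ne_empty.2 fun he => hx.ne' ?_)
    simp only [truncSpline, ← Finset.sum_filter, he, Finset.sum_empty, mul_zero]
  | succ p ih =>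
    obtain ⟨y, hxy, hy, h⟩ := h
    have h1 := ih hy h
    have h2 : truncSpline S s Y 0 x ≠ truncSpline S s Y 0 y := fun he => by
      rw [he] at hx
      linarith
    have h3 := card_filter_lt_of_truncSpline_zero_ne hxy h2
    omega

theorem Alternates.le_card {σ a : ℝ} {p : ℕ} (h : Alternates (truncSpline S s Y q) σ a p) :
    p ≤ S.card := by
  induction q with
  | zero =>
    cases p with
    | zero => exact Nat.zero_le _
    | succ p =>
      obtain ⟨x, _, hx, h⟩ := h
      exact (h.lt_card hx).trans_le (Finset.card_filter_le _ _)
  | succ q ih => exact ih h.pred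

theorem Alternates.add_le_card {σ a c : ℝ} {p : ℕ} (hac : a < c)
    (hz : ∀ x < c, truncSpline S s Y q x = 0)
    (h : Alternates (truncSpline S s Y q) σ a (p + 1)) :
    p + 1 + (q + 1) ≤ S.card := by
  induction q generalizing σ p with
  | zero =>
    obtain ⟨x, hax, hx, h⟩ := h
    have h1 := h.lt_card hx
    have h2 : truncSpline S s Y 0 a ≠ truncSpline S s Y 0 x := fun he => by
      rw [← he, hz a hac] at hx
      simp at hx
    have h3 := card_filter_lt_of_truncSpline_zero_ne hax h2
    have h4 := Finset.card_filter_le S (a < Y ·)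
    omega
  | succ q ih =>
    have := ih (truncSpline_eq_zero_of_succ hz) (h.pred_of_eq_zero (hz a hac))
    omega

theorem exists_alternates_two {u c v : ℝ} (huc : u ≤ c) (hcv : c ≤ v)
    (hu : truncSpline S s Y (q + 1) u = 0) (hv : truncSpline S s Y (q + 1) v = 0)
    (hc : truncSpline S s Y (q + 1) c ≠ 0) :
    ∃ σ, Alternates (truncSpline S s Y q) σ u 2 := by
  have hpos := mul_self_pos.2 hc
  obtain ⟨y, hy, hy'⟩ := exists_pos_of_truncSpline_lt (S := S) (s := s) (Y := Y) (q := q)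
    (σ := -truncSpline S s Y (q + 1) c) huc (by rw [hu]; linarith)
  obtain ⟨z, hz, hz'⟩ := exists_pos_of_truncSpline_lt (S := S) (s := s) (Y := Y) (q := q)
    (σ := truncSpline S s Y (q + 1) c) hcv (by rw [hv]; linarith)
  exact ⟨_, y, hy.1, hy', z, hy.2.trans hz.1, by rwa [neg_neg], trivial⟩

theorem Alternates.cons_gap {u c v σ : ℝ} {p : ℕ} (huc : u ≤ c) (hcv : c ≤ v)
    (hu : truncSpline S s Y (q + 1) u = 0) (hv : truncSpline S s Y (q + 1) v = 0)
    (hc : truncSpline S s Y (q + 1) c ≠ 0) (h : Alternates (truncSpline S s Y q) σ v (p + 1)) :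
    Alternates (truncSpline S s Y q) (-σ) u (p + 2) := by
  have hσ : σ ≠ 0 := by
    rintro rfl
    obtain ⟨x, _, hx, _⟩ := h
    simp at hx
  suffices ∃ y ∈ Icc u v, 0 < -σ * truncSpline S s Y q y by
    obtain ⟨y, hy, hy'⟩ := this
    exact ⟨y, hy.1, hy', by rw [neg_neg]; exact h.mono hy.2⟩
  rcases lt_or_gt_of_ne (mul_ne_zero (neg_ne_zero.2 hσ) hc) with h0 | h0
  · obtain ⟨y, hy, hy'⟩ := exists_pos_of_truncSpline_lt (σ := -σ) (S := S) (s := s) (Y := Y)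
      (q := q) huc (by rw [hu]; linarith)
    exact ⟨y, ⟨hy.1, hy.2.trans hcv⟩, hy'⟩
  · obtain ⟨y, hy, hy'⟩ := exists_pos_of_truncSpline_lt (σ := -σ) (S := S) (s := s) (Y := Y)
      (q := q) hcv (by rw [hv]; linarith)
    exact ⟨y, ⟨huc.trans hy.1, hy.2⟩, hy'⟩

/-- Left of all its knots a truncated spline is a polynomial, so it vanishes there as soon as it
vanishes on an interval. -/
theorem truncSpline_eq_zero_of_Ioo {u v c : ℝ} (huv : u < v) (hvc : v ≤ c)
    (hS : ∀ j ∈ S, c ≤ Y j) (h : ∀ x ∈ Ioo u v, truncSpline S s Y q x = 0) :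
    ∀ x < c, truncSpline S s Y q x = 0 := by
  let P : Polynomial ℝ :=
    ∑ j ∈ S, Polynomial.C (s j) * (Polynomial.C (Y j) - Polynomial.X) ^ q
  have hP : ∀ x < c, truncSpline S s Y q x = P.eval x := fun x hx => by
    simp only [P, Polynomial.eval_finsetSum, Polynomial.eval_mul, Polynomial.eval_pow,
      Polynomial.eval_sub, Polynomial.eval_C, Polynomial.eval_X]
    exact Finset.sum_congr rfl fun j hj => if_pos (hx.trans_le (hS j hj))
  have hP0 : P = 0 := by
    refine Polynomial.eq_zero_of_infinite_isRoot _ ((Ioo_infinite huv).mono fun x hx => ?_)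
    rw [mem_ofPred_eq, Polynomial.IsRoot, ← hP x (hx.2.trans_le hvc)]
    exact h x hx
  intro x hx
  rw [hP x hx, hP0, Polynomial.eval_zero]

theorem truncSpline_Ico_eq {a b j : ℕ} {x : ℝ} (haj : a ≤ j) (hjb : j ≤ b)
    (h : ∀ i ∈ Finset.Ico a j, Y i ≤ x) :
    truncSpline (Finset.Ico a b) s Y q x = truncSpline (Finset.Ico j b) s Y q x := by
  unfold truncSpline
  rw [← Finset.sum_Ico_consecutive _ haj hjb, Finset.sum_eq_zero, zero_add]
  exact fun i hi => if_neg (not_lt.2 (h i hi))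

/-- If a truncated spline vanishes on an interval, so does the tail of the sum that is active
there, on everything left of its first knot. -/
theorem exists_tail_eq_zero {a b : ℕ} {u v : ℝ} (hab : a < b) (hY : StrictMonoOn Y (Iio b))
    (huv : u < v) (hu : u < Y (b - 1))
    (h : ∀ x ∈ Ioo u v, truncSpline (Finset.Ico a b) s Y q x = 0) :
    ∃ j ∈ Finset.Ico a b, u < Y j ∧ ∀ x < Y j, truncSpline (Finset.Ico j b) s Y q x = 0 := by
  classical
  have hex : ∃ j, a ≤ j ∧ u < Y j := ⟨b - 1, by omega, hu⟩
  obtain ⟨haj, huj⟩ := Nat.find_spec hex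
  have hjb : Nat.find hex ≤ b - 1 := Nat.find_min' hex ⟨by omega, hu⟩
  have hmin : ∀ i ∈ Finset.Ico a (Nat.find hex), Y i ≤ u := fun i hi => by
    rw [Finset.mem_Ico] at hi
    by_contra! hc
    exact Nat.find_min hex hi.2 ⟨hi.1, hc⟩
  refine ⟨_, Finset.mem_Ico.2 ⟨haj, by omega⟩, huj, ?_⟩
  refine truncSpline_eq_zero_of_Ioo (lt_min huv huj) (min_le_right _ _) (fun i hi => ?_)
    fun x hx => ?_
  · rw [Finset.mem_Ico] at hi
    exact hY.monotoneOn (show _ < b by omega) hi.2 hi.1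
  · rw [← truncSpline_Ico_eq haj (by omega) fun i hi => (hmin i hi).trans hx.1.le]
    exact h x ⟨hx.1, hx.2.trans_le (min_le_left _ _)⟩

/-- The case in which no proper tail of the sum vanishes left of its first knot. -/
theorem not_forall_truncSpline_eq_zero {X : ℕ → ℝ} {a b : ℕ} (hab : a + 1 < b)
    (hX : StrictMonoOn X (Iio b)) (hY : StrictMonoOn Y (Iio b)) (hXY : ∀ i < b, X i < Y i)
    (hYX : ∀ i, i + (q + 2) < b → Y i < X (i + (q + 2)))
    (htail : ∀ j, a < j → j < b → ¬ ∀ x < Y j, truncSpline (Finset.Ico j b) s Y (q + 1) x = 0) :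
    ¬ ∀ i ∈ Finset.Ico a b, truncSpline (Finset.Ico a b) s Y (q + 1) (X i) = 0 := by
  intro hs
  set f := truncSpline (Finset.Ico a b) s Y (q + 1) with hf
  have hgap : ∀ u v, u < v → u < Y (b - 1) → (Y a ≤ u ∨ ¬ ∀ x < Y a, f x = 0) →
      ∃ c, u ≤ c ∧ c ≤ v ∧ f c ≠ 0 := by
    intro u v huv hu hua
    by_contra! hc
    obtain ⟨j, hj, huj, hz⟩ := exists_tail_eq_zero (by omega) hY huv hu
      fun x hx => hc x hx.1.le hx.2.le
    rw [Finset.mem_Ico] at hj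
    rcases hj.1.eq_or_lt with rfl | haj
    · exact hua.elim (fun h => absurd huj (not_lt.2 h)) fun h => h hz
    · exact htail j haj hj.2 hz
  have hlast : f (Y (b - 1)) = 0 := truncSpline_eq_zero_of_le fun j hj => by
    rw [Finset.mem_Ico] at hj
    exact hY.monotoneOn hj.2 (show _ < b by omega) (by omega)
  have hXlast : ∀ i < b, X i < Y (b - 1) := fun i hi =>
    (hXY i hi).trans_le (hY.monotoneOn hi (show _ < b by omega) (by omega))
  have hdesc : ∀ d i, i + d + 1 = b → a ≤ i → (Y a ≤ X i ∨ ¬ ∀ x < Y a, f x = 0) →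
      ∃ σ, Alternates (truncSpline (Finset.Ico a b) s Y q) σ (X i) (d + 2) := by
    intro d
    induction d with
    | zero =>
      intro i hi hai hcond
      have hib : i < b := by omega
      obtain ⟨c, huc, hcv, hc⟩ := hgap _ _ (hXlast i hib) (hXlast i hib) hcond
      exact exists_alternates_two huc hcv (hs i (Finset.mem_Ico.2 ⟨hai, hib⟩)) hlast hc
    | succ d ih =>
      intro i hi hai hcond
      have hib : i < b := by omega
      have hib' : i + 1 < b := by omega
      have hlt : X i < X (i + 1) := hX hib hib' (Nat.lt_succ_self i)
      obtain ⟨σ, hσ⟩ := ih (i + 1) (by omega) (by omega) (hcond.imp_left fun h => h.trans hlt.le)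
      obtain ⟨c, huc, hcv, hc⟩ := hgap _ _ hlt (hXlast i hib) hcond
      exact ⟨_, hσ.cons_gap huc hcv (hs i (Finset.mem_Ico.2 ⟨hai, hib⟩))
        (hs _ (Finset.mem_Ico.2 ⟨by omega, hib'⟩)) hc⟩
  by_cases hleft : ∀ x < Y a, f x = 0
  · have ha : a < b := by omega
    have hXa := hs a (Finset.mem_Ico.2 ⟨le_rfl, ha⟩)
    have hYa : Y a < Y (b - 1) := hY ha (show _ < b by omega) (by omega)
    have hz := truncSpline_eq_zero_of_succ hleft
    by_cases hk : a + (q + 2) < b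
    · have hlt := hYX a hk
      obtain ⟨σ, hσ⟩ := hdesc (b - (a + (q + 2)) - 1) (a + (q + 2)) (by omega) (by omega)
        (Or.inl hlt.le)
      obtain ⟨c, huc, hcv, hc⟩ := hgap _ _ hlt hYa (Or.inl le_rfl)
      have := (hσ.cons_gap ((hXY a ha).le.trans huc) hcv hXa
        (hs _ (Finset.mem_Ico.2 ⟨by omega, hk⟩)) hc).add_le_card (hXY a ha) hz
      rw [Nat.card_Ico] at this
      omega
    · obtain ⟨c, huc, hcv, hc⟩ := hgap _ _ hYa hYa (Or.inl le_rfl)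
      obtain ⟨σ, hσ⟩ := exists_alternates_two ((hXY a ha).le.trans huc) hcv hXa hlast hc
      have := hσ.add_le_card (hXY a ha) hz
      rw [Nat.card_Ico] at this
      omega
  · obtain ⟨σ, hσ⟩ := hdesc (b - a - 1) a (by omega) le_rfl (Or.inr hleft)
    have := hσ.le_card
    rw [Nat.card_Ico] at this
    omega

theorem eq_zero_of_truncSpline_eq_zero {X : ℕ → ℝ} {m : ℕ}
    (hX : StrictMonoOn X (Iio m)) (hY : StrictMonoOn Y (Iio m)) (hXY : ∀ i < m, X i < Y i)
    (hYX : ∀ i, i + (q + 2) < m → Y i < X (i + (q + 2))) (d : ℕ) :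
    ∀ a b, b ≤ a + d → b ≤ m →
      (∀ i ∈ Finset.Ico a b, truncSpline (Finset.Ico a b) s Y (q + 1) (X i) = 0) →
      ∀ j ∈ Finset.Ico a b, s j = 0 := by
  induction d with
  | zero =>
    intro a b hab _ _ j hj
    rw [Finset.mem_Ico] at hj
    omega
  | succ d ih =>
    intro a b hab hbm hs
    rcases le_or_gt b (a + 1) with hb | hb
    · intro j hj
      have hj' := hs j hj
      rw [Finset.mem_Ico] at hj
      obtain rfl : j = a := by omega
      obtain rfl : b = j + 1 := by omega
      have hpos := hXY j (by omega)
      rw [truncSpline, Nat.Ico_succ_singleton, Finset.sum_singleton, if_pos hpos] at hj'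
      exact (mul_eq_zero.1 hj').resolve_right (pow_ne_zero _ (sub_pos.2 hpos).ne')
    have hsub : Iio b ⊆ Iio m := Iio_subset_Iio hbm
    obtain ⟨j, haj, hjb, hz⟩ : ∃ j, a < j ∧ j < b ∧
        ∀ x < Y j, truncSpline (Finset.Ico j b) s Y (q + 1) x = 0 := by
      by_contra! hc
      refine not_forall_truncSpline_eq_zero hb (hX.mono hsub) (hY.mono hsub)
        (fun i hi => hXY i (by omega)) (fun i hi => hYX i (by omega)) (fun j haj hjb h => ?_) hs
      obtain ⟨x, hx, hne⟩ := hc j haj hjb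
      exact hne (h x hx)
    have hright : ∀ i ∈ Finset.Ico a b,
        truncSpline (Finset.Ico j b) s Y (q + 1) (X i) = 0 := fun i hi => by
      rcases lt_or_ge (X i) (Y j) with h | h
      · exact hz _ h
      · rw [← truncSpline_Ico_eq haj.le hjb.le fun l hl => ?_]
        · exact hs i hi
        · rw [Finset.mem_Ico] at hl
          exact (hY (show _ < m by omega) (show _ < m by omega) hl.2).le.trans h
    have hleft : ∀ i ∈ Finset.Ico a b,
        truncSpline (Finset.Ico a j) s Y (q + 1) (X i) = 0 := fun i hi => by
      have h1 := hs i hi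
      have h2 := hright i hi
      unfold truncSpline at h1 h2 ⊢
      rwa [← Finset.sum_Ico_consecutive _ haj.le hjb.le, h2, add_zero] at h1
    intro l hl
    rw [Finset.mem_Ico] at hl
    rcases lt_or_ge l j with h | h
    · exact ih a j (by omega) (by omega)
        (fun i hi => hleft i (Finset.Ico_subset_Ico_right hjb.le hi)) l
        (Finset.mem_Ico.2 ⟨hl.1, h⟩)
    · exact ih j b (by omega) (by omega)
        (fun i hi => hright i (Finset.Ico_subset_Ico_left haj.le hi)) l
        (Finset.mem_Ico.2 ⟨h, hl.2⟩)

end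

/-- Let `k ≥ 2`, `0 < X₁ < … < X_n`, and `Y₁ < … < Y_m` with `m ≤ n`, `Xᵢ < Yᵢ` for all
`i ≤ m`, and `Y_{i-k} < Xᵢ` whenever `i - k ≥ 1` (1-indexed; here `i : Fin n`, so the
1-indexed index is `i.val + 1` and the condition reads `k ≤ i.val`).  If
`∑ⱼ sⱼ (Yⱼ - Xᵢ)₊^{k-1} = 0` for every `i`, then all `sⱼ` vanish. -/
theorem spline_linear_independence (k n m : ℕ) (hk : 2 ≤ k) (hm : m ≤ n)
    (X : Fin n → ℝ) (hX : StrictMono X) (hXpos : ∀ i, 0 < X i)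
    (Y : Fin m → ℝ) (hY : StrictMono Y)
    (hXY : ∀ j : Fin m, X (Fin.castLE hm j) < Y j)
    (hYX : ∀ i : Fin n, k ≤ i.val → ∀ h : i.val - k < m, Y ⟨i.val - k, h⟩ < X i)
    (s : Fin m → ℝ)
    (hs : ∀ i : Fin n, ∑ j, s j * max (Y j - X i) 0 ^ (k - 1) = 0) :
    ∀ j, s j = 0 := by
  obtain ⟨q, rfl⟩ := Nat.exists_eq_add_of_le' hk
  let X' : ℕ → ℝ := fun i => if h : i < n then X ⟨i, h⟩ else 0
  let Y' : ℕ → ℝ := fun i => if h : i < m then Y ⟨i, h⟩ else 0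
  let s' : ℕ → ℝ := fun i => if h : i < m then s ⟨i, h⟩ else 0
  have hX' : ∀ i (h : i < m), X' i = X ⟨i, h.trans_le hm⟩ := fun i h => dif_pos (h.trans_le hm)
  have hY' : ∀ i (h : i < m), Y' i = Y ⟨i, h⟩ := fun i h => dif_pos h
  have hs' : ∀ i (h : i < m), s' i = s ⟨i, h⟩ := fun i h => dif_pos h
  have key := eq_zero_of_truncSpline_eq_zero (s := s') (Y := Y') (q := q) (X := X') (m := m)
    (fun i hi j hj hij => by rw [hX' i hi, hX' j hj]; exact hX hij)
    (fun i hi j hj hij => by rw [hY' i hi, hY' j hj]; exact hY hij)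
    (fun i hi => by rw [hX' i hi, hY' i hi]; exact hXY ⟨i, hi⟩)
    (fun i hi => by
      have him : i < m := by omega
      rw [hX' _ hi, hY' i him]
      have := hYX ⟨i + (q + 2), by omega⟩ (by simp) (by simpa using him)
      simpa using this)
    m 0 m (by omega) le_rfl
    (fun i hi => by
      have him : i < m := (Finset.mem_Ico.1 hi).2
      rw [← hs ⟨i, him.trans_le hm⟩, truncSpline, ← Finset.range_eq_Ico, Finset.sum_range]
      refine Finset.sum_congr rfl fun j _ => ?_
      rw [hX' i him, hY' j j.2, hs' j j.2]
      split_ifs with h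
      · rw [max_eq_left (by linarith)]
        rfl
      · rw [max_eq_right (by linarith)]
        simp)
  intro j
  rw [← hs' j j.2]
  exact key j (Finset.mem_Ico.2 ⟨Nat.zero_le _, j.2⟩)
end

section
/- Let Ĝ be the (unique) maximum likelihood estimator, and let Y₁ < Y₂ < … < Y_m be the points of its support. Then Y_m > X_n; that is, the largest support point of the MLE mixing measure strictly exceeds the largest observation. -/
open Set MeasureTheory

/-- The mixture density of a point mass at `y` is the kernel at `y`. -/
lemma mixDens_dirac (k : ℕ) (y x : ℝ) :
    mixDens k (Measure.dirac y) x = (k : ℝ) * max (y - x) 0 ^ (k - 1) / y ^ k := by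
  simp [mixDens]

/-- The mixture density vanishes at any point which bounds almost all of the mixing measure. -/
lemma mixDens_eq_zero_of_ae_le {k : ℕ} (hk : 2 ≤ k) {G : Measure ℝ} {x : ℝ}
    (h : ∀ᵐ y ∂G, y ≤ x) : mixDens k G x = 0 := by
  refine integral_eq_zero_of_ae ?_
  filter_upwards [h] with y hy
  rw [max_eq_right (sub_nonpos.2 hy), zero_pow (by omega)]
  simp

/-- A point mass beyond all (positive) observations has positive likelihood. -/
lemma lik_dirac_pos {k n : ℕ} (hk : 1 ≤ k) {X : Fin n → ℝ} {y : ℝ} (hy : 0 < y)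
    (hX : ∀ i, X i < y) : 0 < lik k n X (Measure.dirac y) := by
  refine Finset.prod_pos fun i _ => ?_
  rw [mixDens_dirac]
  have hk' : (0 : ℝ) < k := by exact_mod_cast hk
  have hmax : 0 < max (y - X i) 0 := lt_max_of_lt_left (sub_pos.2 (hX i))
  positivity

/-- If the MLE `Ĝ` is a discrete measure whose support consists of the points
`Y₁ < … < Y_m`, then the largest support point strictly exceeds the largest
observation: `Y_m > X_n`. -/
theorem mle_largest_support_point (k n : ℕ) (hk : 2 ≤ k) (hn : 1 ≤ n)
    (X : Fin n → ℝ) (hX : StrictMono X) (hXpos : ∀ i, 0 < X i)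
    (G : Measure ℝ) (hG : IsMLE k n X G)
    (m : ℕ) (hm : 1 ≤ m) (Y : Fin m → ℝ) (hY : StrictMono Y)
    (hsupp : G {y | y ∉ range Y} = 0) (hatoms : ∀ j, G {Y j} ≠ 0) :
    X ⟨n - 1, by omega⟩ < Y ⟨m - 1, by omega⟩ := by
  by_contra! hle
  obtain ⟨-, -, hmax⟩ := hG
  set x := X ⟨n - 1, by omega⟩ with hx
  have hXle : ∀ i, X i ≤ x := fun i => hX.monotone (Fin.mk_le_mk.2 (by omega))
  have hae : ∀ᵐ y ∂G, y ≤ x := by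
    have hrange : ∀ᵐ y ∂G, y ∈ range Y := hsupp
    filter_upwards [hrange] with y hy
    obtain ⟨j, rfl⟩ := hy
    exact (hY.monotone (Fin.mk_le_mk.2 (by omega))).trans hle
  have hzero : lik k n X G = 0 :=
    Finset.prod_eq_zero (Finset.mem_univ _) (mixDens_eq_zero_of_ae_le hk hae)
  have hxpos : 0 < x + 1 := by linarith [hXpos ⟨n - 1, by omega⟩]
  have hpos := lik_dirac_pos (k := k) (by omega) hxpos fun i => (hXle i).trans_lt (lt_add_one x)
  have hlik := hmax (Measure.dirac (x + 1)) inferInstance (by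
    rw [Measure.dirac_apply' _ measurableSet_Iic]
    simpa using hxpos)
  linarith
end
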